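/- arXiv:1703.08145 — 2 statements merged into one kernel-verified Lean document; each statement's English description precedes it below -/
import Mathlib

section
/- The Fourier coefficients satisfy a₀^{(16)}(4m, 4n) = a₀^{(8)}(2m, 2n) = a₀^{(4)}(m, n), a₀^{(9)}(3m, 3n) = a₀^{(3)}(m, n), and a₀^{(25)}(5m, 5n) = a₀^{(5)}(m, n) for all positive integers m, n. -/
open scoped Manifold
open Complex UpperHalfPlane ModularForm Matrix MatrixGroups

noncomputable def qq (z : ℂ) : ℂ := Complex.exp (2 * Real.pi * Complex.I * z)

noncomputable def dedekindEta (z : ℂ) : ℂ :=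
  Complex.exp (Real.pi * Complex.I * z / 12) * ∏' n : ℕ, (1 - qq ((n + 1) * z))

/-- `f` is a weakly holomorphic modular form of weight `k` on `Γ₀(N)`
whose only possible pole among the cusps is at `∞`. -/
def IsWeaklyHolomorphicSharp (k : ℤ) (N : ℕ) (f : ℍ → ℂ) : Prop :=
  MDifferentiable 𝓘(ℂ) 𝓘(ℂ) f ∧
  (∀ γ ∈ CongruenceSubgroup.Gamma0 N, f ∣[k] γ = f) ∧
  (∀ γ : SL(2, ℤ), ∃ M : ℕ,
    UpperHalfPlane.IsBoundedAtImInfty (fun z => qq z ^ M * (f ∣[k] γ) z)) ∧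
  (∀ γ : SL(2, ℤ), ¬ ((N : ℤ) ∣ (γ : Matrix (Fin 2) (Fin 2) ℤ) 1 0) →
    UpperHalfPlane.IsBoundedAtImInfty (f ∣[k] γ))

/-- `f` additionally vanishes at every cusp other than `∞`. -/
def IsWeaklyHolomorphicSharpCusp (k : ℤ) (N : ℕ) (f : ℍ → ℂ) : Prop :=
  IsWeaklyHolomorphicSharp k N f ∧
  (∀ γ : SL(2, ℤ), ¬ ((N : ℤ) ∣ (γ : Matrix (Fin 2) (Fin 2) ℤ) 1 0) →
    UpperHalfPlane.IsZeroAtImInfty (f ∣[k] γ))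

/-- `f` is the canonical basis element `f_{0,m}^{(N)}` with coefficients `a`. -/
def IsCanonicalBasis0 (N : ℕ) (m : ℕ) (f : ℍ → ℂ) (a : ℕ → ℤ) : Prop :=
  IsWeaklyHolomorphicSharp 0 N f ∧
  ∀ z : ℍ, f z = qq z ^ (-(m : ℤ)) + ∑' n : ℕ, (a (n + 1) : ℂ) * qq z ^ ((n : ℕ) + 1)

noncomputable def Uop (p : ℕ) (f : ℍ → ℂ) : ℍ → ℂ := fun z =>
  (p : ℂ)⁻¹ * ∑ j ∈ Finset.range p, f (((j : ℝ) / p) +ᵥ z)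

noncomputable def Vop (p : ℕ) (f : ℍ → ℂ) : ℍ → ℂ := fun z =>
  if h : 0 < p then
    f ⟨p * z, by simpa using mul_pos (by exact_mod_cast h : (0:ℝ) < p) z.2⟩
  else 0

open Filter Topology

/-- The upper triangular matrix `!![a, b; 0, d]` as an element of `GL(2, ℝ)`. -/
noncomputable def upperTriangular (a b d : ℝ) (h : a * d ≠ 0) : GL (Fin 2) ℝ :=
  Matrix.GeneralLinearGroup.mkOfDetNeZero !![a, b; 0, d] (by simpa [Matrix.det_fin_two] using h)

/-- The operator `U_p`, as the sum of the weight-zero slash actions of the matrices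
`!![1, j; 0, p]` for `0 ≤ j < p`. -/
noncomputable def slashU (p : ℕ) (hp : (1 : ℝ) * p ≠ 0) (f : ℍ → ℂ) : ℍ → ℂ :=
  ∑ j ∈ Finset.range p, f ∣[(0 : ℤ)] upperTriangular 1 j p hp

lemma mem_Gamma0_iff_dvd {N : ℕ} {γ : SL(2, ℤ)} :
    γ ∈ CongruenceSubgroup.Gamma0 N ↔ (N : ℤ) ∣ γ.1 1 0 := by
  rw [CongruenceSubgroup.Gamma0_mem, ZMod.intCast_zmod_eq_zero_iff_dvd]

lemma upperTriangular_mul_eq {a b d a' b' d' : ℤ} {h h'} {γ γ' : SL(2, ℤ)}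
    (H : !![a, b; 0, d] * γ.1 = γ'.1 * !![a', b'; 0, d']) :
    upperTriangular a b d h * (γ : GL (Fin 2) ℝ) =
      (γ' : GL (Fin 2) ℝ) * upperTriangular a' b' d' h' := by
  have H' := congrArg (fun A : Matrix (Fin 2) (Fin 2) ℤ => A.map (Int.cast : ℤ → ℝ)) H
  ext i k
  have := congrFun (congrFun H' i) k
  fin_cases i <;> fin_cases k <;>
    simpa [upperTriangular, Matrix.GeneralLinearGroup.mkOfDetNeZero, Matrix.mul_apply,
      Matrix.vecMul, dotProduct, Fin.sum_univ_two] using this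

lemma exists_upperTriangular_mul_eq {a b c d p : ℤ} (hp : p ≠ 0) (hdet : a * d - b * c = p) :
    ∃ (γ' : SL(2, ℤ)) (g β δ : ℤ), g * δ = p ∧ c = γ'.1 1 0 * g ∧
      !![a, b; c, d] = γ'.1 * !![g, β; 0, δ] := by
  have hg : 0 < Int.gcd a c := by
    rw [Int.gcd_pos_iff]
    by_contra! h
    exact hp (by rw [← hdet, h.1, h.2]; ring)
  obtain ⟨u, v, huv, hu, hv⟩ := Int.exists_gcd_one hg
  obtain ⟨x, y, hxy⟩ := Int.isCoprime_iff_gcd_eq_one.mpr huv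
  generalize (Int.gcd a c : ℤ) = g at hu hv
  subst hu hv
  refine ⟨⟨!![u, -y; v, x], by rw [Matrix.det_fin_two_of]; linarith⟩, g, x * b + y * d,
    u * d - v * b, by linarith, by simp, ?_⟩
  ext i k
  fin_cases i <;> fin_cases k <;> simp [Matrix.mul_apply, Fin.sum_univ_two]
  · linear_combination -b * hxy
  · linear_combination -d * hxy

/-- `U_p` maps functions bounded at the cusps of `Γ₀(pM)` other than `∞` to functions bounded at
the cusps of `Γ₀(M)` other than `∞`. -/
lemma isBoundedAtImInfty_slashU_slash {p M : ℕ} {hp} {f : ℍ → ℂ}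
    (hf : ∀ γ : SL(2, ℤ), ¬ (((p * M : ℕ) : ℤ) ∣ γ.1 1 0) →
      IsBoundedAtImInfty (f ∣[(0 : ℤ)] γ))
    (γ : SL(2, ℤ)) (hγ : ¬ ((M : ℤ) ∣ γ.1 1 0)) :
    IsBoundedAtImInfty (slashU p hp f ∣[(0 : ℤ)] γ) := by
  have hp0 : (p : ℤ) ≠ 0 := by rintro h; simp_all
  rw [ModularForm.SL_slash, slashU, SlashAction.sum_slash]
  refine (boundedAtImInftySubalgebra ℂ).sum_mem fun j _ => ?_
  change IsBoundedAtImInfty _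
  rw [← SlashAction.slash_mul]
  have hdet := γ.2
  rw [Matrix.det_fin_two] at hdet
  obtain ⟨γ', g, β, δ, hgδ, hc, H⟩ :=
    exists_upperTriangular_mul_eq (a := γ.1 0 0 + j * γ.1 1 0) (b := γ.1 0 1 + j * γ.1 1 1)
      (c := p * γ.1 1 0) (d := p * γ.1 1 1) hp0 (by linear_combination (p : ℤ) * hdet)
  have hgδ' : (g : ℝ) * δ ≠ 0 := by
    have : g * δ ≠ 0 := hgδ ▸ hp0
    exact_mod_cast this
  have key := upperTriangular_mul_eq (a := 1) (b := j) (d := p) (h := by simpa using hp)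
    (h' := hgδ') (γ := γ) (γ' := γ') (by
      rw [← H]
      ext i k
      fin_cases i <;> fin_cases k <;> simp [Matrix.mul_apply, Fin.sum_univ_two])
  simp only [Int.cast_one, Int.cast_natCast] at key
  rw [key, SlashAction.slash_mul]
  refine IsBoundedAtImInfty.slash 0 (by simp [upperTriangular, Matrix.GeneralLinearGroup.mkOfDetNeZero])
    (hf γ' fun hdvd => hγ ?_)
  have : (p : ℤ) * M ∣ p * γ.1 1 0 := by
    rw [hc]
    exact Dvd.dvd.mul_right (by exact_mod_cast hdvd) _
  exact Int.dvd_of_mul_dvd_mul_left hp0 this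

/-- If `p ∣ M` then `U_p` maps `Γ₀(pM)`-invariant functions to `Γ₀(M)`-invariant functions. -/
lemma slashU_slash {p M : ℕ} {hp} (hpM : p ∣ M) {f : ℍ → ℂ}
    (hf : ∀ γ ∈ CongruenceSubgroup.Gamma0 (p * M), f ∣[(0 : ℤ)] γ = f)
    {γ : SL(2, ℤ)} (hγ : γ ∈ CongruenceSubgroup.Gamma0 M) :
    slashU p hp f ∣[(0 : ℤ)] γ = slashU p hp f := by
  have hp0 : (p : ℤ) ≠ 0 := by rintro h; simp_all
  rw [mem_Gamma0_iff_dvd] at hγ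
  have hpc : (p : ℤ) ∣ γ.1 1 0 := (Int.natCast_dvd_natCast.mpr hpM).trans hγ
  have hdet := γ.2
  rw [Matrix.det_fin_two] at hdet
  obtain ⟨e, he⟩ := hpc
  set a := γ.1 0 0
  set b := γ.1 0 1
  set c := γ.1 1 0
  set d := γ.1 1 1
  let σ : ℕ → ℕ := fun j => ((d * (b + j * d)) % p).toNat
  have hσ (j : ℕ) : (σ j : ℤ) = (d * (b + j * d)) % p :=
    Int.toNat_of_nonneg (Int.emod_nonneg _ hp0)
  have hσ_mem (j : ℕ) : σ j ∈ Finset.range p := by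
    have := Int.emod_lt_of_pos (d * (b + j * d)) (by positivity : (0 : ℤ) < p)
    rw [Finset.mem_range]
    have := hσ j
    lia
  have hσ_inj : Set.InjOn σ (Finset.range p) := by
    intro j hj k hk hjk
    have h1 : d * (b + j * d) ≡ d * (b + k * d) [ZMOD p] := by
      change _ % _ = _ % _
      rw [← hσ, ← hσ, hjk]
    have h2 : (j : ℤ) ≡ k [ZMOD p] := by
      rw [Int.modEq_iff_dvd] at h1 ⊢
      obtain ⟨t, ht⟩ := h1
      refine ⟨a ^ 2 * t - (k - j) * (a * d + 1) * b * e, ?_⟩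
      linear_combination a ^ 2 * ht - (k - j) * (a * d + 1) * hdet - (k - j) * (a * d + 1) * b * he
    have h3 := Int.natCast_modEq_iff.mp h2
    simp only [Finset.coe_range, Set.mem_Iio] at hj hk
    exact h3.eq_of_lt_of_lt hj hk
  have hσ_image : (Finset.range p).image σ = Finset.range p :=
    Finset.eq_of_subset_of_card_le (Finset.image_subset_iff.mpr fun j _ => hσ_mem j)
      (Finset.card_image_of_injOn hσ_inj).ge
  rw [ModularForm.SL_slash, slashU, SlashAction.sum_slash]
  conv_rhs => rw [← hσ_image, Finset.sum_image hσ_inj]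
  refine Finset.sum_congr rfl fun j _ => ?_
  obtain ⟨t, ht⟩ : (p : ℤ) ∣ b + j * d - σ j * (a + j * c) := by
    have h1 := Int.mul_ediv_add_emod (d * (b + j * d)) p
    rw [← hσ] at h1
    refine ⟨(a + j * c) * (d * (b + j * d) / p) - e * (b + j * d) ^ 2, ?_⟩
    linear_combination -(a + j * c) * h1 - (b + j * d) * hdet - (b + j * d) ^ 2 * he
  let γ' : SL(2, ℤ) := ⟨!![a + j * c, t; p * c, d - σ j * c], by
    rw [Matrix.det_fin_two_of]; linear_combination hdet + c * ht⟩
  have hγ' : γ' ∈ CongruenceSubgroup.Gamma0 (p * M) := by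
    rw [mem_Gamma0_iff_dvd]
    simpa [γ'] using mul_dvd_mul_left (p : ℤ) hγ
  have key := upperTriangular_mul_eq (a := 1) (b := j) (d := p) (h := by simpa using hp)
    (a' := 1) (b' := σ j) (d' := p) (h' := by simpa using hp) (γ := γ) (γ' := γ') (by
      ext i k
      fin_cases i <;> fin_cases k <;> simp [Matrix.mul_apply, Fin.sum_univ_two, γ', a, c, d]
      · linear_combination ht
      · ring)
  simp only [Int.cast_one, Int.cast_natCast] at key
  rw [← SlashAction.slash_mul, key, SlashAction.slash_mul, ← ModularForm.SL_slash, hf γ' hγ']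

lemma mdifferentiable_slashU {p : ℕ} {hp} {f : ℍ → ℂ}
    (hf : MDifferentiable 𝓘(ℂ) 𝓘(ℂ) f) : MDifferentiable 𝓘(ℂ) 𝓘(ℂ) (slashU p hp f) :=
  MDifferentiable.sum fun _ _ => hf.slash 0 _

lemma coe_upperTriangular_smul {p : ℕ} {hp} (j : ℝ) (z : ℍ) :
    (↑(upperTriangular 1 j p hp • z) : ℂ) = (z + j) / p := by
  have hdet : 0 < (upperTriangular 1 j p hp).det.val := by
    have : (0 : ℝ) < p := (Nat.cast_nonneg p).lt_of_ne fun h => by simp [← h] at hp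
    simpa [upperTriangular, Matrix.GeneralLinearGroup.mkOfDetNeZero] using this
  rw [coe_smul_of_det_pos hdet]
  simp [num, denom, upperTriangular, Matrix.GeneralLinearGroup.mkOfDetNeZero]

lemma slashU_apply {p : ℕ} {hp} (f : ℍ → ℂ) (z : ℍ) :
    slashU p hp f z =
      (p : ℂ)⁻¹ * ∑ j ∈ Finset.range p, f (upperTriangular 1 j p hp • z) := by
  have hp' : (0 : ℝ) < p := (Nat.cast_nonneg p).lt_of_ne fun h => by simp [← h] at hp
  rw [slashU, Finset.sum_apply, Finset.mul_sum]
  refine Finset.sum_congr rfl fun j _ => ?_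
  have hdet : (upperTriangular 1 j p hp).det.val = p := by
    simp [upperTriangular, Matrix.GeneralLinearGroup.mkOfDetNeZero]
  rw [ModularForm.slash_apply, hdet, σ, hdet, if_pos hp']
  simp [mul_comm]

/-- The `q`-series of a canonical basis element with a genuine pole at `∞` converges on all of `ℍ`:
otherwise the element would equal `q ^ (-m)` near the real line, which is not `Γ₀(N)`-invariant. -/
lemma IsCanonicalBasis0.summable {N m : ℕ} {f : ℍ → ℂ} {a : ℕ → ℤ}
    (hf : IsCanonicalBasis0 N m f a) (hN : 0 < N) (hm : 0 < m) (z : ℍ) :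
    Summable fun n : ℕ => (a (n + 1) : ℂ) * qq z ^ (n + 1) := by
  by_contra hz
  have norm_qq (w : ℍ) : ‖qq w‖ = Real.exp (-(2 * Real.pi * w.im)) := by
    rw [qq, Complex.norm_exp]
    congr 1
    simp
  have hf_eq (w : ℍ) (hw : w.im < z.im) : f w = qq w ^ (-(m : ℤ)) := by
    rw [hf.2 w, tsum_eq_zero_of_not_summable, add_zero]
    intro hsum
    apply hz
    rw [summable_nat_add_iff (f := fun n : ℕ => (a n : ℂ) * qq w ^ n) 1] at hsum
    rw [summable_nat_add_iff (f := fun n : ℕ => (a n : ℂ) * qq z ^ n) 1]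
    refine summable_powerSeries_of_norm_lt hsum.hasSum.tendsto_sum_nat.cauchySeq ?_
    rw [norm_qq, norm_qq, Real.exp_lt_exp, neg_lt_neg_iff]
    gcongr
  let γ : SL(2, ℤ) := ⟨!![1, 0; N, 1], by simp [Matrix.det_fin_two_of]⟩
  have hγ : γ ∈ CongruenceSubgroup.Gamma0 N := by
    rw [mem_Gamma0_iff_dvd]
    simp [γ]
  let w : ℍ := ⟨(z.im / 2 : ℝ) * Complex.I, by simpa using z.im_pos⟩
  have hw_im : w.im = z.im / 2 := by
    rw [← UpperHalfPlane.coe_im]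
    simp [w]
  have hγw : (γ • w).im < w.im := by
    have h1 : 1 < Complex.normSq (denom γ w) := by
      have h2 : denom γ w = (1 : ℝ) + (N * w.im : ℝ) * Complex.I := by
        rw [ModularGroup.denom_apply, hw_im]
        simp [γ, w]
        ring
      rw [h2, Complex.normSq_add_mul_I]
      have : 0 < N * w.im := mul_pos (by exact_mod_cast hN) w.im_pos
      nlinarith
    rw [ModularGroup.im_smul_eq_div_normSq]
    exact div_lt_self w.im_pos h1
  have h := congrFun (hf.1.2.1 γ hγ) w
  rw [ModularForm.SL_slash_apply, hf_eq w (by linarith [z.im_pos]),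
    hf_eq _ (by linarith [z.im_pos])] at h
  have h' := congrArg norm h
  simp only [norm_inv, norm_pow, norm_qq, neg_zero, zpow_zero, mul_one,
    _root_.zpow_neg, zpow_natCast, _root_.inv_inj] at h'
  rw [pow_left_inj₀ (Real.exp_pos _).le (Real.exp_pos _).le hm.ne', Real.exp_eq_exp, neg_inj,
    mul_right_inj' (by positivity)] at h'
  exact hγw.ne h'

/-- The `q`-expansion of the regular part of a canonical basis element. -/
lemma IsCanonicalBasis0.hasSum {N m : ℕ} {f : ℍ → ℂ} {a : ℕ → ℤ}
    (hf : IsCanonicalBasis0 N m f a) (hN : 0 < N) (hm : 0 < m) (z : ℍ) :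
    HasSum (fun n : ℕ => if n = 0 then 0 else (a n : ℂ) * qq z ^ n)
      (f z - qq z ^ (-(m : ℤ))) := by
  rw [← hasSum_nat_add_iff' 1, hf.2 z]
  simpa using (hf.summable hN hm z).hasSum

/-- `U_p` picks out the coefficients of a `q`-expansion whose index is divisible by `p`. -/
lemma hasSum_slashU {p m : ℕ} {hp} {f : ℍ → ℂ} {c : ℕ → ℂ}
    (hf : ∀ z : ℍ, HasSum (fun n : ℕ => c n * qq z ^ n) (f z - qq z ^ (-((p * m : ℕ) : ℤ))))
    (z : ℍ) :
    HasSum (fun n : ℕ => c (p * n) * qq z ^ n) (slashU p hp f z - qq z ^ (-(m : ℤ))) := by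
  have hp0 : p ≠ 0 := by rintro rfl; simp at hp
  have hpC : (p : ℂ) ≠ 0 := by exact_mod_cast hp0
  set r : ℂ := qq (z / p) with hr
  set ζ : ℂ := qq (1 / p) with hζ
  have hζ_prim : IsPrimitiveRoot ζ p := by
    rw [hζ, qq, mul_one_div]
    exact Complex.isPrimitiveRoot_exp p hp0
  have hr_pow : r ^ p = qq z := by
    rw [hr, qq, qq, ← Complex.exp_nat_mul]
    congr 1
    field_simp
  have hqq (j : ℕ) : qq (upperTriangular 1 j p hp • z : ℍ) = ζ ^ j * r := by
    rw [coe_upperTriangular_smul, hr, hζ, qq, qq, qq, ← Complex.exp_nat_mul, ← Complex.exp_add]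
    congr 1
    push_cast
    field_simp
    ring
  have hpole (j : ℕ) :
      qq (upperTriangular 1 j p hp • z : ℍ) ^ (-((p * m : ℕ) : ℤ)) = qq z ^ (-(m : ℤ)) := by
    rw [hqq, _root_.zpow_neg, _root_.zpow_neg, zpow_natCast, zpow_natCast, pow_mul, mul_pow,
      hr_pow, ← pow_mul, mul_comm j, pow_mul, hζ_prim.pow_eq_one, one_pow, one_mul]
  have hsum := (hasSum_sum fun j (_ : j ∈ Finset.range p) =>
    hf (upperTriangular 1 j p hp • z)).mul_left (p : ℂ)⁻¹
  simp only [hpole, Finset.sum_sub_distrib, Finset.sum_const, Finset.card_range, nsmul_eq_mul,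
    mul_sub, ← slashU_apply, inv_mul_cancel_left₀ hpC] at hsum
  have hinj : Function.Injective fun n : ℕ => p * n := mul_right_injective₀ hp0
  rw [← hinj.hasSum_iff] at hsum
  · refine hsum.congr_fun fun n => ?_
    have (j : ℕ) : (ζ ^ j * r) ^ (p * n) = qq z ^ n := by
      rw [pow_mul, mul_pow, hr_pow, ← pow_mul, mul_comm j, pow_mul, hζ_prim.pow_eq_one, one_pow,
        one_mul]
    simp only [Function.comp_apply, hqq, this, Finset.sum_const, Finset.card_range, nsmul_eq_mul,
      inv_mul_cancel_left₀ hpC]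
  · intro n hn
    have hζn : ζ ^ n ≠ 1 := fun h => hn (by
      obtain ⟨k, rfl⟩ := hζ_prim.dvd_of_pow_eq_one n h
      exact ⟨k, rfl⟩)
    have hgeom : ∑ j ∈ Finset.range p, (ζ ^ n) ^ j = 0 := by
      rw [geom_sum_eq hζn, ← pow_mul, mul_comm, pow_mul, hζ_prim.pow_eq_one, one_pow, sub_self,
        zero_div]
    have (j : ℕ) : c n * (ζ ^ j * r) ^ n = c n * r ^ n * (ζ ^ n) ^ j := by
      rw [mul_pow, ← pow_mul, ← pow_mul, mul_comm j]
      ring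
    simp only [hqq, this, ← Finset.mul_sum, hgeom, mul_zero]

/-- Comparison of canonical basis coefficients at levels `pM` and `M` when `p ∣ M`. -/
lemma IsCanonicalBasis0.coeff_mul_eq {p M m : ℕ} {f g : ℍ → ℂ} {a b : ℕ → ℤ}
    (hpM : p ∣ M) (hM : 0 < M) (hm : 0 < m)
    (hf : IsCanonicalBasis0 (p * M) (p * m) f a) (hg : IsCanonicalBasis0 M m g b)
    {n : ℕ} (hn : 0 < n) : a (p * n) = b n := by
  have hp0 : 0 < p := Nat.pos_of_dvd_of_pos hpM hM
  have hp : (1 : ℝ) * p ≠ 0 := by simpa using hp0.ne'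
  have : NeZero M := ⟨hM.ne'⟩
  let c : ℕ → ℂ := fun n => if n = 0 then 0 else (a (p * n) : ℂ) - b n
  have hsum (z : ℍ) : HasSum (fun n => c n • qq z ^ n) ((slashU p hp f - g) z) := by
    have h1 := hasSum_slashU (hp := hp) (c := fun n => if n = 0 then 0 else (a n : ℂ)) (fun z => by
      simpa using hf.hasSum (by positivity) (by positivity) z) z
    have h2 := h1.sub (hg.hasSum hM hm z)
    rw [sub_sub_sub_cancel_right] at h2
    refine h2.congr_fun fun k => ?_
    by_cases hk : k = 0 <;> simp [c, hk, hp0.ne', sub_mul]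
  have hsum' (z : ℍ) : HasSum (fun n => c n • Function.Periodic.qParam 1 z ^ n)
      ((slashU p hp f - g) z) := by
    simpa [qq, Function.Periodic.qParam] using hsum z
  have hslash {γ : SL(2, ℤ)} (hγ : γ ∈ CongruenceSubgroup.Gamma0 M) :
      (slashU p hp f - g) ∣[(0 : ℤ)] γ = slashU p hp f - g := by
    rw [sub_eq_add_neg, SlashAction.add_slash, SlashAction.neg_slash,
      slashU_slash hpM hf.1.2.1 hγ, hg.1.2.1 γ hγ]
  let F : ModularForm (CongruenceSubgroup.Gamma0 M : Subgroup (GL (Fin 2) ℝ)) 0 :=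
    { toFun := slashU p hp f - g
      slash_action_eq' := by
        rintro _ ⟨γ, hγ, rfl⟩
        exact hslash hγ
      holo' := (mdifferentiable_slashU hf.1.1).sub hg.1.1
      bdd_at_cusps' := by
        intro x hx
        rw [Subgroup.IsArithmetic.isCusp_iff_isCusp_SL2Z] at hx
        rw [OnePoint.isBoundedAt_iff_forall_SL2Z hx]
        intro γ _
        by_cases hγ : (M : ℤ) ∣ γ.1 1 0
        · rw [hslash (mem_Gamma0_iff_dvd.mpr hγ)]
          exact isBoundedAtImInfty_of_hasSum_qExpansion one_pos hsum'
        · rw [sub_eq_add_neg, SlashAction.add_slash, SlashAction.neg_slash]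
          exact (boundedAtImInftySubalgebra ℂ).add_mem
            (isBoundedAtImInfty_slashU_slash hf.1.2.2.2 γ hγ)
            ((boundedAtImInftySubalgebra ℂ).neg_mem (hg.1.2.2.2 γ hγ)) }
  obtain ⟨C, hC⟩ := F.eq_const_of_weight_zero
  have hper : (1 : ℝ) ∈ (CongruenceSubgroup.Gamma0 M : Subgroup (GL (Fin 2) ℝ)).strictPeriods := by
    simp
  have h1 := ModularFormClass.qExpansion_coeff_unique (f := F) one_pos hper hsum' n
  have h2 := ModularFormClass.qExpansion_coeff_unique (f := F) (c := fun n => if n = 0 then C else 0)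
    one_pos hper (fun τ => by
      rw [hC, Function.const_apply]
      convert hasSum_ite_eq 0 C using 2 with k
      aesop) n
  have h3 := h1.trans h2.symm
  simp only [c, hn.ne', if_false, sub_eq_zero] at h3
  exact_mod_cast h3

/-- Coefficient identities between the canonical bases of levels
`16, 8, 4`, of `9, 3`, and of `25, 5`. -/
theorem coeff_identities
    (f16 f8 f4 f9 f3 f25 f5 : ℕ → ℍ → ℂ)
    (a16 a8 a4 a9 a3 a25 a5 : ℕ → ℕ → ℤ)
    (h16 : ∀ m, IsCanonicalBasis0 16 m (f16 m) (a16 m))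
    (h8 : ∀ m, IsCanonicalBasis0 8 m (f8 m) (a8 m))
    (h4 : ∀ m, IsCanonicalBasis0 4 m (f4 m) (a4 m))
    (h9 : ∀ m, IsCanonicalBasis0 9 m (f9 m) (a9 m))
    (h3 : ∀ m, IsCanonicalBasis0 3 m (f3 m) (a3 m))
    (h25 : ∀ m, IsCanonicalBasis0 25 m (f25 m) (a25 m))
    (h5 : ∀ m, IsCanonicalBasis0 5 m (f5 m) (a5 m)) :
    ∀ m n : ℕ, 0 < m → 0 < n →
      a16 (4 * m) (4 * n) = a4 m n ∧
      a8 (2 * m) (2 * n) = a4 m n ∧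
      a9 (3 * m) (3 * n) = a3 m n ∧
      a25 (5 * m) (5 * n) = a5 m n := by
  intro m n hm hn
  have h2 (k : ℕ) (hk : 0 < k) (l : ℕ) (hl : 0 < l) : a8 (2 * k) (2 * l) = a4 k l :=
    (h8 (2 * k)).coeff_mul_eq (p := 2) (M := 4) (by norm_num) (by norm_num) hk (h4 k) hl
  refine ⟨?_, h2 m hm n hn, ?_, ?_⟩
  · rw [← h2 m hm n hn, show 4 * m = 2 * (2 * m) by ring, show 4 * n = 2 * (2 * n) by ring]
    exact (h16 (2 * (2 * m))).coeff_mul_eq (p := 2) (M := 8) (by norm_num) (by norm_num)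
      (by positivity) (h8 (2 * m)) (by positivity)
  · exact (h9 (3 * m)).coeff_mul_eq (p := 3) (M := 3) (by norm_num) (by norm_num) hm (h3 m) hn
  · exact (h25 (5 * m)).coeff_mul_eq (p := 5) (M := 5) (by norm_num) (by norm_num) hm (h5 m) hn
end

section
/- Write m = 2^α m', n = 2^β n' with m', n' odd. If α > β, then a₀^{(8)}(m,n) ≡ 0 (mod 2^{4(α−β)+8}) and a₀^{(16)}(m,n) ≡ 0 (mod 2^{4(α−β)+8}); if β > α, then a₀^{(8)}(m,n) ≡ 0 (mod 2^{3(β−α)+8}) and a₀^{(16)}(m,n) ≡ 0 (mod 2^{3(β−α)+8}). -/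
open scoped Manifold
open Complex UpperHalfPlane ModularForm Matrix MatrixGroups

/-- `F` has no terms of degree below `n`, and its coefficient in degree `n` is `c`. -/
def HasLead (F : LaurentSeries ℤ) (n c : ℤ) : Prop :=
  (∀ j < n, F.coeff j = 0) ∧ F.coeff n = c

/-- All terms of `F` have positive degree. -/
def IsPositive (F : LaurentSeries ℤ) : Prop := ∀ j ≤ 0, F.coeff j = 0

lemma HasLead.mul {F G : LaurentSeries ℤ} {n m c d : ℤ} (hF : HasLead F n c)
    (hG : HasLead G m d) : HasLead (F * G) (n + m) (c * d) := by
  constructor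
  · intro j hj
    rw [HahnSeries.coeff_mul]
    refine Finset.sum_eq_zero fun p hp => ?_
    rw [Finset.mem_antidiagonal] at hp
    rcases lt_or_ge p.1 n with h | h
    · rw [hF.1 _ h, zero_mul]
    · rw [hG.1 p.2 (by omega), mul_zero]
  · rw [HahnSeries.coeff_mul, Finset.sum_eq_single (n, m)]
    · rw [hF.2, hG.2]
    · intro p hp hne
      rw [Finset.mem_antidiagonal] at hp
      rcases lt_trichotomy p.1 n with h | h | h
      · rw [hF.1 _ h, zero_mul]
      · exact absurd (Prod.ext h (by dsimp only; omega)) hne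
      · rw [hG.1 p.2 (by omega), mul_zero]
    · intro h
      by_contra hne
      apply h
      rw [Finset.mem_antidiagonal]
      exact ⟨left_ne_zero_of_mul hne, right_ne_zero_of_mul hne, rfl⟩

lemma hasLead_one : HasLead 1 0 1 :=
  ⟨fun j hj => by rw [HahnSeries.coeff_one, if_neg hj.ne], by simp⟩

lemma HasLead.pow {F : LaurentSeries ℤ} {n c : ℤ} (hF : HasLead F n c) (k : ℕ) :
    HasLead (F ^ k) (k * n) (c ^ k) := by
  induction k with
  | zero => simpa using hasLead_one
  | succ k ih =>
    have := ih.mul hF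
    rw [pow_succ, pow_succ]
    convert this using 1
    push_cast; ring

lemma HasLead.add {F G : LaurentSeries ℤ} {n c d : ℤ} (hF : HasLead F n c)
    (hG : HasLead G n d) : HasLead (F + G) n (c + d) :=
  ⟨fun j hj => by simp [hF.1 j hj, hG.1 j hj], by simp [hF.2, hG.2]⟩

lemma HasLead.of_lt {F : LaurentSeries ℤ} {n m c : ℤ} (hF : HasLead F n c) (h : m < n) :
    HasLead F m 0 :=
  ⟨fun j hj => hF.1 j (hj.trans h), hF.1 m h⟩

lemma HasLead.ne_zero {F : LaurentSeries ℤ} {n c : ℤ} (hF : HasLead F n c) (hc : c ≠ 0) :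
    F ≠ 0 := by
  rintro rfl
  exact hc (by simpa using hF.2.symm)

lemma coeff_zsmul_series (a : ℤ) (F : LaurentSeries ℤ) (j : ℤ) :
    ((a : LaurentSeries ℤ) * F).coeff j = a * F.coeff j := by
  rw [← zsmul_eq_mul, HahnSeries.coeff_smul, smul_eq_mul]

lemma coeff_intCast_series (a j : ℤ) :
    ((a : LaurentSeries ℤ)).coeff j = if j = 0 then a else 0 := by
  rw [← mul_one (a : LaurentSeries ℤ), coeff_zsmul_series, HahnSeries.coeff_one]
  split_ifs <;> simp

lemma hasLead_intCast (a : ℤ) : HasLead (a : LaurentSeries ℤ) 0 a :=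
  ⟨fun j hj => by rw [coeff_intCast_series, if_neg hj.ne], by simp [coeff_intCast_series]⟩

lemma HasLead.isUnit {F : LaurentSeries ℤ} {n : ℤ} (hF : HasLead F n 1) : IsUnit F := by
  have h0 := hF.ne_zero one_ne_zero
  have hn : F.order = n := by
    refine le_antisymm (HahnSeries.order_le_of_coeff_ne_zero (by rw [hF.2]; exact one_ne_zero)) ?_
    by_contra! h
    exact HahnSeries.coeff_order_eq_zero.not.mpr h0 (hF.1 _ h)
  rw [HahnSeries.isUnit_iff, HahnSeries.leadingCoeff_eq, hn, hF.2]
  exact isUnit_one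

lemma aeval_coeff (y : LaurentSeries ℤ) (P : Polynomial ℤ) (j : ℤ) :
    (Polynomial.aeval y P).coeff j =
      ∑ i ∈ Finset.range (P.natDegree + 1), P.coeff i * (y ^ i).coeff j := by
  rw [Polynomial.aeval_eq_sum_range, HahnSeries.coeff_sum]
  refine Finset.sum_congr rfl fun i _ => ?_
  rw [Algebra.smul_def, eq_intCast, coeff_zsmul_series]

lemma hasLead_aeval {y : LaurentSeries ℤ} (hy : HasLead y (-1) 1) (P : Polynomial ℤ) :
    HasLead (Polynomial.aeval y P) (-P.natDegree) P.leadingCoeff := by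
  have key (i : ℕ) := hy.pow i
  constructor
  · intro j hj
    rw [aeval_coeff]
    refine Finset.sum_eq_zero fun i hi => ?_
    rw [Finset.mem_range] at hi
    rw [(key i).1 j (by omega), mul_zero]
  · rw [aeval_coeff, Finset.sum_eq_single P.natDegree]
    · have := (key P.natDegree).2
      rw [mul_neg_one] at this
      simp [this]
    · intro i hi hne
      rw [Finset.mem_range] at hi
      rw [(key i).1 _ (by omega), mul_zero]
    · simp

lemma aeval_eq_zero_of_isPositive {y : LaurentSeries ℤ} (hy : HasLead y (-1) 1)
    {P : Polynomial ℤ} (hP : IsPositive (Polynomial.aeval y P)) : P = 0 := by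
  rw [← Polynomial.leadingCoeff_eq_zero, ← (hasLead_aeval hy P).2]
  exact hP _ (by omega)

lemma exists_aeval_sub_isPositive {y : LaurentSeries ℤ} (hy : HasLead y (-1) 1) (N : ℕ)
    (F : LaurentSeries ℤ) (hF : ∀ j < -(N : ℤ), F.coeff j = 0) :
    ∃ P : Polynomial ℤ, IsPositive (F - Polynomial.aeval y P) := by
  induction N generalizing F with
  | zero =>
    refine ⟨Polynomial.C (F.coeff 0), fun j hj => ?_⟩
    rcases hj.lt_or_eq with h | rfl
    · simp [hF j (by simpa using h), coeff_intCast_series, h.ne]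
    · simp [coeff_intCast_series]
  | succ N ih =>
    obtain ⟨P, hP⟩ := ih (F - (F.coeff (-(N + 1 : ℕ) : ℤ) : LaurentSeries ℤ) * y ^ (N + 1)) (by
      intro j hj
      rw [HahnSeries.coeff_sub, coeff_zsmul_series]
      have h1 := hy.pow (N + 1)
      rcases lt_or_eq_of_le (show j ≤ -((N + 1 : ℕ) : ℤ) by push_cast; omega) with h | h
      · rw [hF j h, h1.1 j (by linarith)]; simp
      · have := h1.2
        rw [mul_neg_one, ← h] at this
        rw [← h, this]; simp)
    refine ⟨P + Polynomial.C (F.coeff (-(N + 1 : ℕ) : ℤ)) * Polynomial.X ^ (N + 1), ?_⟩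
    convert hP using 1
    simp
    ring

/-- `F` is the polynomial in `y` of the form `q ^ (-m) + O(q)`. -/
def IsFaber (y : LaurentSeries ℤ) (m : ℕ) (F : LaurentSeries ℤ) : Prop :=
  (∃ P : Polynomial ℤ, F = Polynomial.aeval y P) ∧
    ∀ j ≤ 0, F.coeff j = if j = -(m : ℤ) then 1 else 0

lemma IsFaber.unique {y : LaurentSeries ℤ} (hy : HasLead y (-1) 1) {m : ℕ}
    {F G : LaurentSeries ℤ} (hF : IsFaber y m F) (hG : IsFaber y m G) : F = G := by
  obtain ⟨⟨P, rfl⟩, hP⟩ := hF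
  obtain ⟨⟨Q, rfl⟩, hQ⟩ := hG
  have : P - Q = 0 := aeval_eq_zero_of_isPositive hy fun j hj => by
    rw [map_sub, HahnSeries.coeff_sub, hP j hj, hQ j hj, sub_self]
  rw [sub_eq_zero.mp this]

lemma exists_isFaber {y : LaurentSeries ℤ} (hy : HasLead y (-1) 1) (m : ℕ) :
    ∃ F, IsFaber y m F := by
  obtain ⟨P, hP⟩ := exists_aeval_sub_isPositive hy m (HahnSeries.single (-(m : ℤ)) 1)
    fun j hj => HahnSeries.coeff_single_of_ne hj.ne
  refine ⟨_, ⟨P, rfl⟩, fun j hj => ?_⟩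
  have := hP j hj
  rw [HahnSeries.coeff_sub, sub_eq_zero] at this
  rw [← this, HahnSeries.coeff_single]
  split_ifs <;> rfl

/-- The derivation `q d/dq` of the ring of formal Laurent series. -/
noncomputable def thetaOp (F : LaurentSeries ℤ) : LaurentSeries ℤ :=
  HahnSeries.ofSuppBddBelow (fun n => n * F.coeff n) (by
    rcases eq_or_ne F 0 with rfl | h
    · simp
    · refine ⟨F.order, fun n hn => HahnSeries.order_le_of_coeff_ne_zero ?_⟩
      exact right_ne_zero_of_mul hn)

@[simp] lemma coeff_thetaOp (F : LaurentSeries ℤ) (n : ℤ) :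
    (thetaOp F).coeff n = n * F.coeff n := rfl

lemma thetaOp_add (F G : LaurentSeries ℤ) : thetaOp (F + G) = thetaOp F + thetaOp G := by
  ext n; simp [mul_add]

lemma support_thetaOp_subset (F : LaurentSeries ℤ) : (thetaOp F).support ⊆ F.support :=
  fun _ hn => right_ne_zero_of_mul hn

lemma thetaOp_mul (F G : LaurentSeries ℤ) :
    thetaOp (F * G) = thetaOp F * G + F * thetaOp G := by
  ext n
  rw [coeff_thetaOp, HahnSeries.coeff_add,
    HahnSeries.coeff_mul_left' F.isPWO_support (support_thetaOp_subset F),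
    HahnSeries.coeff_mul_right' G.isPWO_support (support_thetaOp_subset G),
    HahnSeries.coeff_mul, ← Finset.sum_add_distrib, Finset.mul_sum]
  refine Finset.sum_congr rfl fun p hp => ?_
  rw [Finset.mem_antidiagonal] at hp
  rw [coeff_thetaOp, coeff_thetaOp, ← hp.2.2]
  ring

lemma thetaOp_pow (y : LaurentSeries ℤ) (k : ℕ) :
    y * thetaOp (y ^ k) = (k : LaurentSeries ℤ) * (y ^ k * thetaOp y) := by
  induction k with
  | zero =>
    have : thetaOp 1 = 0 := by
      ext n; simp [HahnSeries.coeff_one]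
    simp [this]
  | succ k ih =>
    rw [pow_succ, thetaOp_mul, mul_add, ← mul_assoc y _ y, ih]
    push_cast; ring

lemma coeff_zero_pow_mul_thetaOp {y : LaurentSeries ℤ} (hy : y ≠ 0) (i j : ℕ) :
    (y ^ i * thetaOp (y ^ j)).coeff 0 = 0 := by
  rcases Nat.eq_zero_or_pos (i + j) with h | h
  · obtain ⟨rfl, rfl⟩ : i = 0 ∧ j = 0 := by omega
    simp
  · have h1 : ((i + j : ℕ) : LaurentSeries ℤ) * (y ^ i * thetaOp (y ^ j)) =
        (j : LaurentSeries ℤ) * thetaOp (y ^ (i + j)) := by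
      apply mul_left_cancel₀ hy
      rw [mul_left_comm y, mul_left_comm y, mul_left_comm y, thetaOp_pow, thetaOp_pow]
      ring
    have h2 := congrArg (fun F => F.coeff 0) h1
    rw [← Int.cast_natCast, ← Int.cast_natCast (R := LaurentSeries ℤ) j] at h2
    simp only [coeff_zsmul_series, coeff_thetaOp, zero_mul, mul_zero] at h2
    exact (mul_eq_zero.mp h2).resolve_left (by exact_mod_cast h.ne')

lemma coeff_zero_aeval_mul_thetaOp {y : LaurentSeries ℤ} (hy : y ≠ 0) (P Q : Polynomial ℤ) :
    (Polynomial.aeval y P * thetaOp (Polynomial.aeval y Q)).coeff 0 = 0 := by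
  induction P using Polynomial.induction_on' with
  | add P P' hP hP' => rw [map_add, add_mul, HahnSeries.coeff_add, hP, hP', add_zero]
  | monomial i a =>
    induction Q using Polynomial.induction_on' with
    | add Q Q' hQ hQ' =>
      rw [map_add, thetaOp_add, mul_add, HahnSeries.coeff_add, hQ, hQ', add_zero]
    | monomial j b =>
      have hb : thetaOp ((b : LaurentSeries ℤ) * y ^ j) = b * thetaOp (y ^ j) := by
        ext n; rw [coeff_thetaOp, coeff_zsmul_series, coeff_zsmul_series, coeff_thetaOp]; ring
      have : Polynomial.aeval y (Polynomial.monomial i a) *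
          thetaOp (Polynomial.aeval y (Polynomial.monomial j b)) =
          ((a * b : ℤ) : LaurentSeries ℤ) * (y ^ i * thetaOp (y ^ j)) := by
        simp only [Polynomial.aeval_monomial, eq_intCast, hb]
        push_cast; ring
      rw [this, coeff_zsmul_series, coeff_zero_pow_mul_thetaOp hy, mul_zero]

/-- Duality between the coefficients of Faber polynomials. -/
lemma IsFaber.duality {y : LaurentSeries ℤ} (hy : y ≠ 0) {m n : ℕ} (hm : 0 < m) (hn : 0 < n)
    {F G : LaurentSeries ℤ} (hF : IsFaber y m F) (hG : IsFaber y n G) :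
    (n : ℤ) * F.coeff n = m * G.coeff m := by
  obtain ⟨⟨P, rfl⟩, hP⟩ := hF
  obtain ⟨⟨Q, rfl⟩, hQ⟩ := hG
  set F := Polynomial.aeval y P
  set G := Polynomial.aeval y Q
  have h0 : (F * thetaOp G).coeff 0 = 0 := coeff_zero_aeval_mul_thetaOp hy P Q
  set E := F - HahnSeries.single (-(m : ℤ)) 1 with hE
  set D := thetaOp G + HahnSeries.single (-(n : ℤ)) (n : ℤ) with hD
  have hElead : HasLead E 1 (E.coeff 1) := ⟨fun j hj => by
    rw [hE, HahnSeries.coeff_sub, hP j (by omega), HahnSeries.coeff_single]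
    split_ifs <;> rfl, rfl⟩
  have hDlead : HasLead D 1 (D.coeff 1) := ⟨fun j hj => by
    rw [hD, HahnSeries.coeff_add, coeff_thetaOp, hQ j (by omega), HahnSeries.coeff_single]
    split_ifs with h
    · simp [h]
    · simp, rfl⟩
  have hexp : F * thetaOp G = E * D - HahnSeries.single (-(n : ℤ)) (n : ℤ) * F +
      HahnSeries.single (-(m : ℤ)) 1 * thetaOp G +
      HahnSeries.single (-(m : ℤ)) 1 * HahnSeries.single (-(n : ℤ)) (n : ℤ) := by
    rw [hE, hD]; ring
  rw [hexp, HahnSeries.coeff_add, HahnSeries.coeff_add, HahnSeries.coeff_sub,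
    (hElead.mul hDlead).1 0 (by norm_num), HahnSeries.coeff_single_mul,
    HahnSeries.coeff_single_mul, coeff_thetaOp, HahnSeries.single_mul_single,
    HahnSeries.coeff_single_of_ne (by omega)] at h0
  simp only [zero_sub, one_mul, sub_neg_eq_add, zero_add, add_zero] at h0
  linarith

instance : CharZero (LaurentSeries ℤ) :=
  ⟨fun a b h => by
    have := congrArg (fun F => F.coeff 0) h
    simp only [← Int.cast_natCast (R := LaurentSeries ℤ), coeff_intCast_series] at this
    simpa using this⟩

/-- The substitution `q ↦ q ^ 2`. -/
noncomputable def dilate : LaurentSeries ℤ →+* LaurentSeries ℤ :=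
  HahnSeries.embDomainRingHom (AddMonoidHom.mulLeft (2 : ℤ))
    (fun a b h => by simpa using h) (fun a b => by simp)

@[simp] lemma coeff_dilate (F : LaurentSeries ℤ) (n : ℤ) :
    (dilate F).coeff (2 * n) = F.coeff n :=
  HahnSeries.embDomain_coeff (f := ⟨⟨AddMonoidHom.mulLeft (2 : ℤ), _⟩, _⟩)

lemma coeff_dilate_of_odd (F : LaurentSeries ℤ) {n : ℤ} (hn : Odd n) :
    (dilate F).coeff n = 0 := by
  refine HahnSeries.embDomain_of_notMem_range ?_
  rintro ⟨k, rfl⟩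
  exact (Int.not_odd_iff_even.mpr (even_two_mul k)) hn

lemma dilate_injective : Function.Injective dilate := fun F G h => by
  ext n
  rw [← coeff_dilate, h, coeff_dilate]

lemma dilate_intCast (c : ℤ) : dilate (c : LaurentSeries ℤ) = c := map_intCast _ _

/-- The operator keeping the terms of even degree and halving the exponents. -/
noncomputable def decimate (F : LaurentSeries ℤ) : LaurentSeries ℤ :=
  HahnSeries.ofSuppBddBelow (fun n => F.coeff (2 * n)) (by
    rcases eq_or_ne F 0 with rfl | h
    · simp
    · refine ⟨F.order / 2, fun n hn => ?_⟩
      have := HahnSeries.order_le_of_coeff_ne_zero (Function.mem_support.mp hn)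
      omega)

@[simp] lemma coeff_decimate (F : LaurentSeries ℤ) (n : ℤ) :
    (decimate F).coeff n = F.coeff (2 * n) := rfl

lemma decimate_add (F G : LaurentSeries ℤ) : decimate (F + G) = decimate F + decimate G := by
  ext n; simp

lemma decimate_dilate (F : LaurentSeries ℤ) : decimate (dilate F) = F := by
  ext n; simp

/-- The substitution `q ↦ -q`. -/
noncomputable def signTwist (F : LaurentSeries ℤ) : LaurentSeries ℤ :=
  HahnSeries.ofSuppBddBelow (fun n => (Int.negOnePow n : ℤ) * F.coeff n) (by
    rcases eq_or_ne F 0 with rfl | h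
    · simp
    · exact ⟨F.order, fun n hn => HahnSeries.order_le_of_coeff_ne_zero (right_ne_zero_of_mul hn)⟩)

@[simp] lemma coeff_signTwist (F : LaurentSeries ℤ) (n : ℤ) :
    (signTwist F).coeff n = (Int.negOnePow n : ℤ) * F.coeff n := rfl

lemma signTwist_add (F G : LaurentSeries ℤ) :
    signTwist (F + G) = signTwist F + signTwist G := by
  ext n; simp [mul_add]

lemma support_signTwist (F : LaurentSeries ℤ) : (signTwist F).support = F.support := by
  ext n; simp

lemma signTwist_mul (F G : LaurentSeries ℤ) :
    signTwist (F * G) = signTwist F * signTwist G := by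
  ext n
  rw [coeff_signTwist, HahnSeries.coeff_mul, HahnSeries.coeff_mul, Finset.mul_sum]
  refine Finset.sum_congr ?_ fun p hp => ?_
  · ext p
    simp only [Finset.mem_antidiagonal, support_signTwist]
  · rw [Finset.mem_antidiagonal] at hp
    rw [coeff_signTwist, coeff_signTwist, ← hp.2.2, Int.negOnePow_add]
    push_cast
    ring

lemma signTwist_dilate (F : LaurentSeries ℤ) : signTwist (dilate F) = dilate F := by
  ext n
  rw [coeff_signTwist]
  rcases Int.even_or_odd n with h | h
  · rw [Int.negOnePow_even n h]; simp
  · rw [coeff_dilate_of_odd F h, mul_zero]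

lemma two_mul_dilate_decimate (F : LaurentSeries ℤ) :
    2 * dilate (decimate F) = F + signTwist F := by
  ext n
  rw [two_mul, HahnSeries.coeff_add, HahnSeries.coeff_add, coeff_signTwist]
  rcases Int.even_or_odd n with h | h
  · rw [Int.negOnePow_even n h]
    obtain ⟨k, rfl⟩ := even_iff_two_dvd.mp h
    simp
  · rw [coeff_dilate_of_odd _ h, Int.negOnePow_odd n h]
    simp

lemma decimate_dilate_mul (F G : LaurentSeries ℤ) :
    decimate (dilate F * G) = F * decimate G := by
  apply dilate_injective
  apply mul_left_cancel₀ (two_ne_zero' (LaurentSeries ℤ))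
  rw [two_mul_dilate_decimate, signTwist_mul, signTwist_dilate, map_mul, mul_left_comm,
    two_mul_dilate_decimate, mul_add]

lemma decimate_intCast_mul (c : ℤ) (F : LaurentSeries ℤ) :
    decimate (c * F) = c * decimate F := by
  rw [← decimate_dilate_mul, dilate_intCast]

/-- The trace of the root `y` of a monic quadratic polynomial over the series in `q ^ 2`. -/
lemma two_mul_decimate_of_quadratic {y b c : LaurentSeries ℤ}
    (h : y ^ 2 = dilate b * y + dilate c) {k : ℤ} (hk : Odd k)
    (hy : y.coeff k ≠ 0) : 2 * decimate y = b := by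
  apply dilate_injective
  rw [map_mul, map_ofNat, two_mul_dilate_decimate]
  have h' : signTwist y ^ 2 = dilate b * signTwist y + dilate c := by
    rw [pow_two, ← signTwist_mul, ← pow_two, h, signTwist_add, signTwist_mul, signTwist_dilate,
      signTwist_dilate]
  have hne : y - signTwist y ≠ 0 := by
    intro h0
    have := congrArg (fun F => F.coeff k) h0
    simp only [HahnSeries.coeff_sub, coeff_signTwist, HahnSeries.coeff_zero] at this
    rw [Int.negOnePow_odd k hk] at this
    simp at this
    omega
  apply mul_left_cancel₀ hne
  linear_combination h - h'

lemma IsFaber.dilate {w y : LaurentSeries ℤ} {c : ℤ} (h : y ^ 2 = dilate w + c) {m : ℕ}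
    {F : LaurentSeries ℤ} (hF : IsFaber w m F) : IsFaber y (2 * m) (_root_.dilate F) := by
  obtain ⟨⟨P, rfl⟩, hP⟩ := hF
  refine ⟨⟨P.comp (Polynomial.X ^ 2 - Polynomial.C c), ?_⟩, fun j hj => ?_⟩
  · have : _root_.dilate w = y ^ 2 - c := by rw [h]; ring
    have hP' : _root_.dilate (Polynomial.aeval w P) = Polynomial.aeval (y ^ 2 - c) P := by
      rw [← this, Polynomial.aeval_def, Polynomial.hom_eval₂, Polynomial.aeval_def]
      congr 1
      exact RingHom.ext_int _ _
    rw [hP', Polynomial.aeval_comp]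
    simp
  · rcases Int.even_or_odd j with h | h
    · obtain ⟨k, rfl⟩ := even_iff_two_dvd.mp h
      rw [coeff_dilate, hP k (by omega)]
      exact if_congr (by push_cast; omega) rfl rfl
    · rw [coeff_dilate_of_odd _ h, if_neg]
      rintro rfl
      exact Int.not_odd_iff_even.mpr (by simp) h

/-- The divisibility by powers of `2` of the coefficients of the Faber polynomials of `y`. -/
def FaberCongruence (y : LaurentSeries ℤ) : Prop :=
  ∀ (α β m n : ℕ) (F : LaurentSeries ℤ), Odd m → Odd n → IsFaber y (2 ^ α * m) F →
    (β < α → (2 : ℤ) ^ (4 * (α - β) + 8) ∣ F.coeff (2 ^ β * n)) ∧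
    (α < β → (2 : ℤ) ^ (3 * (β - α) + 8) ∣ F.coeff (2 ^ β * n))

lemma FaberCongruence.of_sq_eq_dilate {w y : LaurentSeries ℤ} {c : ℤ} (hw : HasLead w (-1) 1)
    (hy : HasLead y (-1) 1) (h : y ^ 2 = dilate w + c) (H : FaberCongruence w) :
    FaberCongruence y := by
  have key (α m : ℕ) (F : LaurentSeries ℤ) (hF : IsFaber y (2 ^ (α + 1) * m) F) :
      ∃ G, IsFaber w (2 ^ α * m) G ∧ F = dilate G := by
    obtain ⟨G, hG⟩ := exists_isFaber hw (2 ^ α * m)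
    refine ⟨G, hG, hF.unique hy ?_⟩
    have := hG.dilate h
    rwa [← mul_assoc, ← pow_succ'] at this
  intro α β m n F hm hn hF
  obtain _ | α := α
  · refine ⟨fun h => absurd h (Nat.not_lt_zero _), fun hβ => ?_⟩
    obtain ⟨β, rfl⟩ := Nat.exists_eq_add_of_lt hβ
    obtain ⟨E, hE⟩ := exists_isFaber hy (2 ^ (β + 1) * n)
    obtain ⟨G, -, rfl⟩ := key β n E hE
    have hd := hF.duality (hy.ne_zero one_ne_zero) (by simpa using hm.pos)
      (by have := hn.pos; positivity) hE
    rw [coeff_dilate_of_odd _ (by simpa using hm), mul_zero] at hd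
    have := (mul_eq_zero.mp hd).resolve_left (by have := hn.pos; positivity)
    push_cast at this
    rw [zero_add, this]
    exact dvd_zero _
  · obtain ⟨G, hG, rfl⟩ := key α m F hF
    obtain _ | β := β
    · rw [coeff_dilate_of_odd _ (by simpa using hn)]
      exact ⟨fun _ => dvd_zero _, fun _ => dvd_zero _⟩
    · rw [pow_succ' (2 : ℤ) β, mul_assoc, coeff_dilate]
      have := H α β m n G hm hn hG
      rw [Nat.add_lt_add_iff_right, Nat.add_lt_add_iff_right, Nat.add_sub_add_right,
        Nat.add_sub_add_right]
      exact this

lemma HasLead.of_mul_eq_one {F G : LaurentSeries ℤ} {n : ℤ} (hF : HasLead F n 1)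
    (h : F * G = 1) : HasLead G (-n) 1 := by
  have hG : HasLead G G.order (G.coeff G.order) :=
    ⟨fun j hj => HahnSeries.coeff_eq_zero_of_lt_order hj, rfl⟩
  have h0 : G.coeff G.order ≠ 0 :=
    HahnSeries.coeff_order_eq_zero.not.mpr (right_ne_zero_of_mul_eq_one h)
  have hm := hF.mul hG
  rw [h, one_mul] at hm
  have hc := hm.2
  rw [HahnSeries.coeff_one] at hc
  split_ifs at hc with hn
  · rwa [← hc, ← neg_eq_of_add_eq_zero_right hn] at hG
  · exact absurd hc.symm h0

/-- The formal analogues of the Hauptmodul of `Γ₀(2)` and of the modular equation of level `2`: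
`t = 256 / φ` and `φ` is quadratic over the series in `q ^ 2`. -/
structure IsLevelTwoPair (φ t : LaurentSeries ℤ) : Prop where
  hasLead : HasLead φ (-1) 1
  mul_eq : φ * t = 256
  modular : φ ^ 2 = dilate (-48 - 16 * t) * φ + dilate φ

namespace IsLevelTwoPair

open Polynomial

variable {φ t : LaurentSeries ℤ}

lemma modular' (h : IsLevelTwoPair φ t) :
    t ^ 2 = dilate (48 * t + 16 * t ^ 2) * t + dilate (256 * t) := by
  have h1 := h.mul_eq
  have h2 : dilate φ * dilate t = 256 := by rw [← map_mul, h1, map_ofNat]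
  have h3 := h.modular
  have hne : (256 : LaurentSeries ℤ) ≠ 0 := by norm_num
  simp only [map_add, map_sub, map_mul, map_neg, map_pow, map_ofNat] at h3 ⊢
  apply mul_left_cancel₀ hne
  linear_combination (-1 : LaurentSeries ℤ) * dilate t * t ^ 2 * h3 +
    dilate t * (φ * t + 256 + (48 + 16 * dilate t) * t) * h1 - t ^ 2 * h2

lemma exists_eq_mul (h : IsLevelTwoPair φ t) : ∃ ψ, HasLead ψ 1 1 ∧ t = (256 : ℤ) * ψ := by
  obtain ⟨ψ, hψ⟩ := h.hasLead.isUnit.exists_right_inv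
  refine ⟨ψ, h.hasLead.of_mul_eq_one hψ, ?_⟩
  apply mul_left_cancel₀ (h.hasLead.ne_zero one_ne_zero)
  rw [mul_left_comm, hψ, h.mul_eq]
  norm_num

lemma hasLead_t (h : IsLevelTwoPair φ t) : HasLead t 1 256 := by
  obtain ⟨ψ, hψ, rfl⟩ := h.exists_eq_mul
  simpa using (hasLead_intCast 256).mul hψ

lemma decimate_φ (h : IsLevelTwoPair φ t) : decimate φ = -24 - 8 * t := by
  have := two_mul_decimate_of_quadratic h.modular (k := -1) (by decide)
    (by rw [h.hasLead.2]; exact one_ne_zero)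
  apply mul_left_cancel₀ (two_ne_zero' (LaurentSeries ℤ))
  rw [this]; ring

lemma decimate_t (h : IsLevelTwoPair φ t) : decimate t = 24 * t + 8 * t ^ 2 := by
  have := two_mul_decimate_of_quadratic h.modular' odd_one
    (by rw [h.hasLead_t.2]; norm_num)
  apply mul_left_cancel₀ (two_ne_zero' (LaurentSeries ℤ))
  rw [this]; ring

/-- The series `P(φ) + 8 t Q(t)`. -/
def IsReducible (φ t F : LaurentSeries ℤ) : Prop :=
  ∃ P Q : ℤ[X], F = aeval φ P + 8 * t * aeval t Q

lemma IsReducible.add {F G : LaurentSeries ℤ} (hF : IsReducible φ t F)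
    (hG : IsReducible φ t G) : IsReducible φ t (F + G) := by
  obtain ⟨P, Q, rfl⟩ := hF
  obtain ⟨P', Q', rfl⟩ := hG
  exact ⟨P + P', Q + Q', by simp only [map_add]; ring⟩

lemma IsReducible.intCast_mul {F : LaurentSeries ℤ} (hF : IsReducible φ t F) (c : ℤ) :
    IsReducible φ t (c * F) := by
  obtain ⟨P, Q, rfl⟩ := hF
  exact ⟨C c * P, C c * Q, by simp only [map_mul, eq_intCast, map_intCast]; ring⟩

lemma exists_aeval_eq_add_mul (y : LaurentSeries ℤ) (P : ℤ[X]) :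
    ∃ (c : ℤ) (Q : ℤ[X]), aeval y P = c + y * aeval y Q :=
  ⟨P.coeff 0, P.divX, by
    conv_lhs => rw [← P.divX_mul_X_add]
    simp only [map_add, map_mul, aeval_X, eq_intCast, map_intCast]
    ring⟩

lemma isReducible_mul_left (h : IsLevelTwoPair φ t) {F : LaurentSeries ℤ}
    (hF : IsReducible φ t F) : IsReducible φ t (φ * F) := by
  obtain ⟨P, Q, rfl⟩ := hF
  obtain ⟨c, R, hR⟩ := exists_aeval_eq_add_mul t Q
  refine ⟨X * P + C (2048 * c), C 256 * R, ?_⟩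
  simp only [map_add, map_mul, aeval_X, eq_intCast, map_intCast, map_ofNat]
  rw [hR]
  linear_combination 8 * ((c : LaurentSeries ℤ) + t * aeval t R) * h.mul_eq

lemma isReducible_sixteen_mul (h : IsLevelTwoPair φ t) {F : LaurentSeries ℤ}
    (hF : IsReducible φ t F) : IsReducible φ t (16 * t * F) := by
  obtain ⟨P, Q, rfl⟩ := hF
  obtain ⟨c, R, hR⟩ := exists_aeval_eq_add_mul φ P
  refine ⟨C 4096 * R, C (2 * c) + C 16 * X * Q, ?_⟩
  simp only [map_add, map_mul, aeval_X, eq_intCast, map_intCast, map_ofNat]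
  rw [hR]
  linear_combination 16 * aeval φ R * h.mul_eq

lemma isReducible_decimate_pow (h : IsLevelTwoPair φ t) (i : ℕ) :
    IsReducible φ t (decimate (φ ^ i)) := by
  induction i using Nat.twoStepInduction with
  | zero => exact ⟨1, 0, by rw [pow_zero, ← map_one dilate, decimate_dilate]; simp⟩
  | one =>
    refine ⟨C (-24), C (-1), ?_⟩
    rw [pow_one, h.decimate_φ]
    simp only [eq_intCast, map_intCast]
    push_cast
    ring
  | more i h0 h1 =>
    have e : φ ^ (i + 2) = dilate (-48 - 16 * t) * φ ^ (i + 1) + dilate φ * φ ^ i := by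
      linear_combination φ ^ i * h.modular
    rw [e, decimate_add, decimate_dilate_mul, decimate_dilate_mul]
    convert ((h1.intCast_mul (-48)).add ((h.isReducible_sixteen_mul h1).intCast_mul (-1))).add
      (h.isReducible_mul_left h0) using 1
    push_cast
    ring

lemma decimate_aeval_isReducible (h : IsLevelTwoPair φ t) (P : ℤ[X]) :
    IsReducible φ t (decimate (aeval φ P)) := by
  induction P using Polynomial.induction_on' with
  | add P Q hP hQ => rw [map_add, decimate_add]; exact hP.add hQ
  | monomial i a =>
    rw [aeval_monomial, eq_intCast, decimate_intCast_mul]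
    exact (h.isReducible_decimate_pow i).intCast_mul a

lemma exists_decimate_pow_t (h : IsLevelTwoPair φ t) (i : ℕ) :
    ∃ Q : ℤ[X], decimate (t ^ (i + 1)) = 8 * t * aeval t Q := by
  have h2 : decimate (t ^ 2) = (48 * t + 16 * t ^ 2) * decimate t + 256 * t := by
    conv_lhs => rw [h.modular', decimate_add, decimate_dilate_mul, decimate_dilate]
  induction i using Nat.twoStepInduction with
  | zero =>
    refine ⟨3 + X, ?_⟩
    rw [zero_add, pow_one, h.decimate_t]
    simp only [map_add, map_ofNat, aeval_X]
    ring
  | one =>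
    refine ⟨(48 * X + 16 * X ^ 2) * (3 + X) + 32, ?_⟩
    rw [h2, h.decimate_t]
    simp only [map_add, map_mul, map_pow, map_ofNat, aeval_X]
    ring
  | more i h0 h1 =>
    obtain ⟨Q, hQ⟩ := h0
    obtain ⟨R, hR⟩ := h1
    have e : t ^ (i + 2 + 1) = dilate (48 * t + 16 * t ^ 2) * t ^ (i + 1 + 1) +
        dilate (256 * t) * t ^ (i + 1) := by
      linear_combination t ^ (i + 1) * h.modular'
    refine ⟨(48 * X + 16 * X ^ 2) * R + 256 * X * Q, ?_⟩
    rw [e, decimate_add, decimate_dilate_mul, decimate_dilate_mul, hQ, hR]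
    simp only [map_add, map_mul, map_pow, map_ofNat, aeval_X]
    ring

lemma exists_decimate_mul_aeval_t (h : IsLevelTwoPair φ t) (P : ℤ[X]) :
    ∃ Q : ℤ[X], decimate (t * aeval t P) = 8 * t * aeval t Q := by
  induction P using Polynomial.induction_on' with
  | add P Q hP hQ =>
    obtain ⟨R, hR⟩ := hP
    obtain ⟨S, hS⟩ := hQ
    exact ⟨R + S, by rw [map_add, mul_add, decimate_add, hR, hS, map_add, mul_add]⟩
  | monomial i a =>
    obtain ⟨Q, hQ⟩ := h.exists_decimate_pow_t i
    refine ⟨C a * Q, ?_⟩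
    rw [aeval_monomial, eq_intCast, mul_left_comm, ← pow_succ', decimate_intCast_mul, hQ]
    simp only [map_mul, eq_intCast, map_intCast]
    ring

lemma dvd_coeff_mul_aeval_t (h : IsLevelTwoPair φ t) (P : ℤ[X]) (k : ℕ) (n : ℤ) :
    (2 : ℤ) ^ (3 * k + 8) ∣ (t * aeval t P).coeff (2 ^ k * n) := by
  induction k generalizing P with
  | zero =>
    obtain ⟨ψ, -, hψ⟩ := h.exists_eq_mul
    nth_rw 1 [hψ]
    rw [mul_assoc, coeff_zsmul_series]
    norm_num
  | succ k ih =>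
    obtain ⟨Q, hQ⟩ := h.exists_decimate_mul_aeval_t P
    rw [pow_succ' (2 : ℤ) k, mul_assoc, ← coeff_decimate, hQ, mul_assoc,
      show (8 : LaurentSeries ℤ) = (8 : ℤ) by norm_num, coeff_zsmul_series,
      show 3 * (k + 1) + 8 = 3 + (3 * k + 8) by ring, pow_add]
    exact mul_dvd_mul (by norm_num) (ih Q)

lemma isPositive_mul_aeval_t (h : IsLevelTwoPair φ t) (P : ℤ[X]) :
    IsPositive (8 * t * aeval t P) := by
  intro j hj
  have ht := h.hasLead_t
  rw [mul_assoc, show (8 : LaurentSeries ℤ) = (8 : ℤ) by norm_num, coeff_zsmul_series]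
  induction P using Polynomial.induction_on' with
  | add P Q hP hQ => rw [map_add, mul_add, HahnSeries.coeff_add, mul_add, hP, hQ, add_zero]
  | monomial i a =>
    rw [aeval_monomial, eq_intCast, mul_left_comm, ← pow_succ', coeff_zsmul_series,
      (ht.pow (i + 1)).1 j (by push_cast; omega), mul_zero, mul_zero]

lemma decimate_eq_of_isFaber (h : IsLevelTwoPair φ t) {m : ℕ} {F G : LaurentSeries ℤ}
    (hF : IsFaber φ (2 * m) F) (hG : IsFaber φ m G) :
    ∃ P : ℤ[X], decimate F = G + 8 * (t * aeval t P) := by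
  obtain ⟨⟨P, rfl⟩, hP⟩ := hF
  obtain ⟨⟨Q, rfl⟩, hQ⟩ := hG
  obtain ⟨R, S, hRS⟩ := h.decimate_aeval_isReducible P
  have : R - Q = 0 := aeval_eq_zero_of_isPositive h.hasLead fun j hj => by
    have e : aeval φ (R - Q) = decimate (aeval φ P) - 8 * t * aeval t S - aeval φ Q := by
      rw [hRS, map_sub]; ring
    rw [e, HahnSeries.coeff_sub, HahnSeries.coeff_sub, h.isPositive_mul_aeval_t S j hj,
      coeff_decimate, hP _ (by omega), hQ _ hj, sub_zero, sub_eq_zero]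
    exact if_congr (by push_cast; omega) rfl rfl
  rw [sub_eq_zero.mp this] at hRS
  exact ⟨S, by rw [hRS, mul_assoc]⟩

lemma decimate_eq_of_isFaber_odd (h : IsLevelTwoPair φ t) {m : ℕ} (hm : Odd m)
    {F : LaurentSeries ℤ} (hF : IsFaber φ m F) :
    ∃ P : ℤ[X], decimate F = 8 * (t * aeval t P) := by
  obtain ⟨⟨P, rfl⟩, hP⟩ := hF
  obtain ⟨R, S, hRS⟩ := h.decimate_aeval_isReducible P
  have : R = 0 := aeval_eq_zero_of_isPositive h.hasLead fun j hj => by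
    have e : aeval φ R = decimate (aeval φ P) - 8 * t * aeval t S := by rw [hRS]; ring
    rw [e, HahnSeries.coeff_sub, h.isPositive_mul_aeval_t S j hj,
      coeff_decimate, hP _ (by omega), sub_zero, if_neg]
    have := hm
    rw [← Int.odd_coe_nat] at this
    intro h2
    rw [← Int.not_even_iff_odd] at this
    exact this ⟨-j, by omega⟩
  exact ⟨S, by rw [hRS, this, map_zero, zero_add, mul_assoc]⟩

lemma dvd_coeff_of_isFaber (h : IsLevelTwoPair φ t) {m : ℕ} (hm : Odd m) (α k : ℕ)
    {F : LaurentSeries ℤ} (hF : IsFaber φ (2 ^ α * m) F) (n : ℤ) :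
    (2 : ℤ) ^ (3 * (k + 1) + 8) ∣ F.coeff (2 ^ (α + (k + 1)) * n) := by
  induction α generalizing F with
  | zero =>
    obtain ⟨P, hP⟩ := h.decimate_eq_of_isFaber_odd hm (by simpa using hF)
    rw [zero_add, pow_succ' (2 : ℤ) k, mul_assoc, ← coeff_decimate, hP,
      show (8 : LaurentSeries ℤ) = (8 : ℤ) by norm_num, coeff_zsmul_series,
      show 3 * (k + 1) + 8 = 3 + (3 * k + 8) by ring, pow_add]
    exact mul_dvd_mul (by norm_num) (h.dvd_coeff_mul_aeval_t P k n)
  | succ α ih =>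
    obtain ⟨G, hG⟩ := exists_isFaber h.hasLead (2 ^ α * m)
    obtain ⟨P, hP⟩ := h.decimate_eq_of_isFaber (by rwa [pow_succ', mul_assoc] at hF) hG
    rw [add_right_comm, pow_succ' (2 : ℤ) (α + (k + 1)), mul_assoc, ← coeff_decimate, hP,
      HahnSeries.coeff_add,
      show (8 : LaurentSeries ℤ) = (8 : ℤ) by norm_num, coeff_zsmul_series]
    refine dvd_add (ih hG) (Dvd.dvd.mul_left ?_ _)
    exact (pow_dvd_pow _ (by omega)).trans (h.dvd_coeff_mul_aeval_t P (α + (k + 1)) n)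

lemma faberCongruence (h : IsLevelTwoPair φ t) : FaberCongruence φ := by
  intro α β m n F hm hn hF
  refine ⟨fun hβ => ?_, fun hα => ?_⟩
  · obtain ⟨k, rfl⟩ := Nat.exists_eq_add_of_lt hβ
    obtain ⟨G, hG⟩ := exists_isFaber h.hasLead (2 ^ β * n)
    have hd := hF.duality (h.hasLead.ne_zero one_ne_zero) (by have := hm.pos; positivity)
      (by have := hn.pos; positivity) hG
    obtain ⟨c, hc⟩ := h.dvd_coeff_of_isFaber hn β k hG m
    push_cast at hd
    rw [add_assoc, hc] at hd
    have h1 : (n : ℤ) * F.coeff (2 ^ β * n) = 2 ^ (4 * (k + 1) + 8) * (m * c) := by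
      apply mul_left_cancel₀ (pow_ne_zero β (two_ne_zero' ℤ))
      rw [← mul_assoc, hd]
      ring
    have h2 : IsCoprime ((2 : ℤ) ^ (4 * (k + 1) + 8)) n :=
      IsCoprime.pow_left (Nat.isCoprime_iff_coprime.mpr (Nat.coprime_two_left.mpr hn))
    rw [show β + k + 1 - β = k + 1 by omega]
    exact h2.dvd_of_dvd_mul_left ⟨_, h1⟩
  · obtain ⟨k, rfl⟩ := Nat.exists_eq_add_of_lt hα
    rw [show α + k + 1 - α = k + 1 by omega]
    exact h.dvd_coeff_of_isFaber hm α k hF n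

end IsLevelTwoPair

/-- The relations between the Hauptmoduln of level `8` and `16` determine the congruences. -/
lemma faberCongruence_of_relations {X H : LaurentSeries ℤ} (hX : HasLead X (-1) 1)
    (hH : HasLead H (-1) 1) (hsq : X ^ 2 = dilate H) (hmul : H * X = X ^ 2 + 4) :
    FaberCongruence H ∧ FaberCongruence X := by
  obtain ⟨K, hK⟩ := hH.isUnit.exists_right_inv
  set g := H + (16 : ℤ) * K with hg
  have hgH : g * H = H ^ 2 + 16 := by
    rw [hg]; push_cast; linear_combination 16 * hK
  have hgl : HasLead g (-1) 1 := by
    rw [hg]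
    simpa using hH.add (((hasLead_intCast 16).mul (hH.of_mul_eq_one hK)).of_lt
      (m := -1) (by norm_num))
  have hVg : dilate g = H ^ 2 - 8 := by
    have h := congrArg dilate hgH
    simp only [map_add, map_mul, map_pow, map_ofNat, ← hsq] at h
    apply mul_right_cancel₀ (pow_ne_zero 2 (hX.ne_zero one_ne_zero))
    rw [h]
    linear_combination (-(H * X) - X ^ 2 - 4) * hmul
  have hg8 : HasLead (g + (8 : ℤ)) (-1) 1 := by
    simpa using hgl.add ((hasLead_intCast 8).of_lt (m := -1) (by norm_num))
  have hg8' : HasLead (g + (-8 : ℤ)) (-1) 1 := by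
    simpa using hgl.add ((hasLead_intCast (-8)).of_lt (m := -1) (by norm_num))
  push_cast at hg8 hg8'
  obtain ⟨J, hJ⟩ := hg8.isUnit.exists_right_inv
  set φ := (g + -8) ^ 2 * J with hφ
  have hφl : HasLead φ (-1) 1 := by
    simpa using (hg8'.pow 2).mul (hg8.of_mul_eq_one hJ)
  have hφg : φ * (g + 8) = (g + -8) ^ 2 := by
    rw [hφ]; linear_combination (g + -8) ^ 2 * hJ
  have hVφ : dilate φ = g ^ 2 - 64 := by
    have h := congrArg dilate hφg
    simp only [map_add, map_mul, map_pow, map_ofNat, map_neg, hVg] at h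
    apply mul_right_cancel₀ (pow_ne_zero 2 (hH.ne_zero one_ne_zero))
    linear_combination h - (g * H + H ^ 2 + 16) * hgH
  obtain ⟨ψ, hψ⟩ := hφl.isUnit.exists_right_inv
  have hpair : IsLevelTwoPair φ (256 * ψ) := by
    refine ⟨hφl, by linear_combination 256 * hψ, ?_⟩
    have hV := congrArg dilate hψ
    simp only [map_mul, map_one] at hV
    simp only [map_sub, map_mul, map_ofNat, map_neg]
    apply mul_left_cancel₀ ((map_ne_zero_iff dilate dilate_injective).mpr
      (hφl.ne_zero one_ne_zero))
    apply mul_left_cancel₀ (pow_ne_zero 2 (hg8.ne_zero one_ne_zero))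
    rw [hVφ] at hV ⊢
    linear_combination ((g ^ 2 - 64) * (φ * (g + 8) + (g + -8) ^ 2) +
      48 * (g ^ 2 - 64) * (g + 8) + 4096 * (g + 8)) * hφg + 4096 * (g + 8) ^ 2 * φ * hV
  have hcg : FaberCongruence g := by
    refine hpair.faberCongruence.of_sq_eq_dilate (c := 64) hφl hgl ?_
    rw [hVφ]; push_cast; ring
  have hcH : FaberCongruence H := by
    refine hcg.of_sq_eq_dilate (c := 8) hgl hH ?_
    rw [hVg]; push_cast; ring
  exact ⟨hcH, hcH.of_sq_eq_dilate (c := 0) hH hX (by rw [hsq]; simp)⟩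

section

open Filter Topology Asymptotics

/-- The affine map `z ↦ r z + s` of the upper half-plane. -/
noncomputable def affineMap (r s : ℝ) (hr : 0 < r) (z : ℍ) : ℍ :=
  ⟨r * z + s, by simpa using mul_pos hr z.im_pos⟩

@[simp] lemma coe_affineMap (r s : ℝ) (hr : 0 < r) (z : ℍ) :
    (affineMap r s hr z : ℂ) = r * z + s := rfl

@[simp] lemma im_affineMap (r s : ℝ) (hr : 0 < r) (z : ℍ) :
    (affineMap r s hr z).im = r * z.im := by
  change (affineMap r s hr z : ℂ).im = _
  simp

lemma tendsto_affineMap (r s : ℝ) (hr : 0 < r) :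
    Tendsto (affineMap r s hr) atImInfty atImInfty := by
  rw [atImInfty, tendsto_comap_iff]
  have : UpperHalfPlane.im ∘ affineMap r s hr = fun z => r * z.im := by
    ext z; simp
  rw [this]
  exact tendsto_comap.const_mul_atTop hr

lemma mdifferentiable_comp_affineMap {f : ℍ → ℂ} (hf : MDifferentiable 𝓘(ℂ) 𝓘(ℂ) f)
    (r s : ℝ) (hr : 0 < r) :
    MDifferentiable 𝓘(ℂ) 𝓘(ℂ) (fun z => f (affineMap r s hr z)) := by
  rw [UpperHalfPlane.mdifferentiable_iff] at hf ⊢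
  have h : DifferentiableOn ℂ ((f ∘ ofComplex) ∘ fun z : ℂ => r * z + s) {z | 0 < z.im} :=
    hf.comp (by fun_prop) fun z hz => by simpa using mul_pos hr hz
  refine h.congr fun z hz => ?_
  have h2 : 0 < ((r : ℂ) * z + s).im := by simpa using mul_pos hr hz
  simp only [Function.comp_apply]
  rw [ofComplex_apply_of_im_pos hz, ofComplex_apply_of_im_pos h2]
  rfl

lemma affineMap_smul {γ γ' : SL(2, ℤ)} {r s r' s' : ℝ} (hr : 0 < r) (hr' : 0 < r') {l : ℝ}
    (hl : l ≠ 0) (h00 : γ' 0 0 * r' = l * (r * γ 0 0 + s * γ 1 0))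
    (h01 : γ' 0 0 * s' + γ' 0 1 = l * (r * γ 0 1 + s * γ 1 1))
    (h10 : γ' 1 0 * r' = l * γ 1 0) (h11 : γ' 1 0 * s' + γ' 1 1 = l * γ 1 1) (z : ℍ) :
    affineMap r s hr (γ • z) = γ' • affineMap r' s' hr' z := by
  have hd : (γ 1 0 : ℂ) * z + γ 1 1 ≠ 0 := by
    simpa [denom] using UpperHalfPlane.denom_ne_zero (γ : GL (Fin 2) ℝ) z
  have hl' : (l : ℂ) ≠ 0 := by exact_mod_cast hl
  apply UpperHalfPlane.ext
  rw [coe_affineMap, coe_specialLinearGroup_apply, coe_specialLinearGroup_apply, coe_affineMap]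
  simp only [algebraMap_int_eq, eq_intCast, ofReal_intCast]
  have e00 := congrArg (fun x : ℝ => (x : ℂ)) h00
  have e01 := congrArg (fun x : ℝ => (x : ℂ)) h01
  have e10 := congrArg (fun x : ℝ => (x : ℂ)) h10
  have e11 := congrArg (fun x : ℝ => (x : ℂ)) h11
  push_cast at e00 e01 e10 e11
  have hden : (γ' 1 0 : ℂ) * (r' * z + s') + γ' 1 1 = l * (γ 1 0 * z + γ 1 1) := by
    linear_combination z * e10 + e11
  have hnum : (γ' 0 0 : ℂ) * (r' * z + s') + γ' 0 1 =
      l * (r * (γ 0 0 * z + γ 0 1) + s * (γ 1 0 * z + γ 1 1)) := by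
    linear_combination z * e00 + e01
  rw [hden, hnum, mul_div_mul_left _ _ hl']
  have key (A B r s : ℂ) (hB : B ≠ 0) : r * (A / B) + s = (r * A + s * B) / B := by field_simp
  exact key _ _ _ _ hd

lemma affineMap_one_zero (z : ℍ) : affineMap 1 0 one_pos z = z := by
  apply UpperHalfPlane.ext
  simp

/-- The functions on the upper half-plane which are holomorphic, invariant under `Γ₀(N)`, and
bounded at all cusps other than `∞`. -/
def sharpSubalgebra (N : ℕ) : Subalgebra ℂ (ℍ → ℂ) where
  carrier := {f | MDifferentiable 𝓘(ℂ) 𝓘(ℂ) f ∧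
    (∀ γ ∈ CongruenceSubgroup.Gamma0 N, ∀ z, f (γ • z) = f z) ∧
    ∀ γ : SL(2, ℤ), ¬ ((N : ℤ) ∣ γ 1 0) → IsBoundedAtImInfty fun z => f (γ • z)}
  mul_mem' := by
    rintro f g ⟨hf, hf', hf''⟩ ⟨hg, hg', hg''⟩
    exact ⟨hf.mul hg, fun γ hγ z => by rw [Pi.mul_apply, Pi.mul_apply, hf' γ hγ z, hg' γ hγ z],
      fun γ hγ => (hf'' γ hγ).mul (hg'' γ hγ)⟩
  add_mem' := by
    rintro f g ⟨hf, hf', hf''⟩ ⟨hg, hg', hg''⟩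
    exact ⟨hf.add hg, fun γ hγ z => by rw [Pi.add_apply, Pi.add_apply, hf' γ hγ z, hg' γ hγ z],
      fun γ hγ => (hf'' γ hγ).add (hg'' γ hγ)⟩
  algebraMap_mem' c := ⟨mdifferentiable_const, fun _ _ _ => rfl,
    fun _ _ => Filter.const_boundedAtFilter _ c⟩

lemma mem_sharpSubalgebra {N : ℕ} {f : ℍ → ℂ} (hf : IsWeaklyHolomorphicSharp 0 N f) :
    f ∈ sharpSubalgebra N := by
  have h (γ : SL(2, ℤ)) : f ∣[(0 : ℤ)] γ = fun z => f (γ • z) := by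
    ext z; simp [ModularForm.SL_slash_apply]
  refine ⟨hf.1, fun γ hγ z => ?_, fun γ hγ => ?_⟩
  · rw [← congrFun (h γ) z, hf.2.1 γ hγ]
  · rw [← h γ]
    exact hf.2.2.2 γ hγ

lemma sharpSubalgebra_eq_const {N : ℕ} [NeZero N] {f : ℍ → ℂ} (hf : f ∈ sharpSubalgebra N)
    (hb : IsBoundedAtImInfty f) : ∃ c, f = fun _ => c := by
  obtain ⟨h1, h2, h3⟩ := hf
  have hs (γ : SL(2, ℤ)) : f ∣[(0 : ℤ)] γ = fun z => f (γ • z) := by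
    ext z; simp [ModularForm.SL_slash_apply]
  let F : ModularForm (CongruenceSubgroup.Gamma0 N : Subgroup (GL (Fin 2) ℝ)) 0 :=
    { toFun := f
      slash_action_eq' := by
        rintro _ ⟨γ, hγ, rfl⟩
        have := hs γ
        rw [ModularForm.SL_slash] at this
        refine this.trans (funext fun z => h2 γ hγ z)
      holo' := h1
      bdd_at_cusps' := by
        intro c hc
        rw [OnePoint.isBoundedAt_iff_forall_SL2Z (hc.mono (by rintro _ ⟨γ, -, rfl⟩; exact ⟨γ, rfl⟩))]
        intro γ _
        rw [hs γ]
        by_cases hγ : γ ∈ CongruenceSubgroup.Gamma0 N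
        · simpa only [h2 γ hγ] using hb
        · refine h3 γ fun h => hγ ?_
          rw [CongruenceSubgroup.Gamma0_mem]
          exact (ZMod.intCast_zmod_eq_zero_iff_dvd _ _).mpr h }
  obtain ⟨c, hc⟩ := ModularForm.eq_const_of_weight_zero F
  exact ⟨c, hc⟩

/-- The function `f` is given near `i∞` by the `q`-series `F`. -/
def IsExpansion (F : LaurentSeries ℤ) (f : ℍ → ℂ) : Prop :=
  ∀ᶠ z : ℍ in atImInfty, HasSum (fun n : ℤ => (F.coeff n : ℂ) * qq z ^ n) (f z)

lemma qq_ne_zero (z : ℂ) : qq z ≠ 0 := Complex.exp_ne_zero _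

lemma qq_add (z w : ℂ) : qq (z + w) = qq z * qq w := by
  rw [qq, qq, qq, ← Complex.exp_add, mul_add]

lemma norm_qq (z : ℍ) : ‖qq z‖ = Real.exp (-2 * Real.pi * z.im) := by
  rw [qq, Complex.norm_exp]
  congr 1
  simp

lemma norm_qq_le {z w : ℍ} (h : z.im ≤ w.im) : ‖qq w‖ ≤ ‖qq z‖ := by
  rw [norm_qq, norm_qq, Real.exp_le_exp]
  have := mul_le_mul_of_nonneg_left h Real.pi_pos.le
  linarith

lemma qq_affineMap_two (z : ℍ) : qq (affineMap 2 0 two_pos z) = qq z ^ 2 := by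
  rw [coe_affineMap, sq, ← qq_add]
  congr 1
  push_cast
  ring

lemma tendsto_exp_im_div {w : ℝ} (hw : 0 < w) :
    Tendsto (fun z : ℍ => Real.exp (-2 * Real.pi * z.im / w)) atImInfty (𝓝 0) := by
  refine Real.tendsto_exp_atBot.comp (Tendsto.atBot_div_const hw ?_)
  exact Tendsto.const_mul_atTop_of_neg (by linarith [Real.pi_pos]) tendsto_comap

lemma tendsto_norm_qq : Tendsto (fun z : ℍ => ‖qq z‖) atImInfty (𝓝 0) := by
  simpa only [norm_qq, div_one] using tendsto_exp_im_div one_pos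

namespace IsExpansion

variable {F G : LaurentSeries ℤ} {f g : ℍ → ℂ}

lemma add (hF : IsExpansion F f) (hG : IsExpansion G g) : IsExpansion (F + G) (f + g) := by
  filter_upwards [hF, hG] with z hz hz'
  convert hz.add hz' using 2 with n
  · simp [add_mul]
  · rfl

lemma _root_.hasSum_coeff_mul (F G : LaurentSeries ℤ) {q : ℂ} (hq : q ≠ 0) (n : ℤ) :
    HasSum (fun a : ℤ => (F.coeff a * q ^ a) * (G.coeff (n - a) * q ^ (n - a)))
      ((F * G).coeff n * q ^ n) := by
  have hinj : Set.InjOn Prod.fst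
      (Finset.antidiagonal F.isPWO_support G.isPWO_support n : Set (ℤ × ℤ)) := by
    intro p hp r hr hpr
    rw [Finset.mem_coe, Finset.mem_antidiagonal] at hp hr
    exact Prod.ext hpr (by omega)
  have hc : ((F * G).coeff n : ℂ) * q ^ n =
      ∑ a ∈ (Finset.antidiagonal F.isPWO_support G.isPWO_support n).image Prod.fst,
        (F.coeff a * q ^ a) * (G.coeff (n - a) * q ^ (n - a)) := by
    rw [Finset.sum_image hinj, HahnSeries.coeff_mul, Int.cast_sum, Finset.sum_mul]
    refine Finset.sum_congr rfl fun p hp => ?_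
    rw [Finset.mem_antidiagonal] at hp
    obtain rfl : p.1 + p.2 = n := hp.2.2
    rw [add_sub_cancel_left, zpow_add₀ hq]
    push_cast
    ring
  rw [hc]
  refine hasSum_sum_of_ne_finset_zero fun a ha => ?_
  by_contra hne
  apply ha
  rw [Finset.mem_image]
  refine ⟨(a, n - a), ?_, rfl⟩
  rw [Finset.mem_antidiagonal]
  refine ⟨fun h0 => hne ?_, fun h0 => hne ?_, add_sub_cancel _ _⟩ <;> simp [h0]

lemma _root_.HasSum.convolution {u v : ℤ → ℂ} {s t : ℂ} (hu : HasSum u s) (hv : HasSum v t)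
    {w : ℤ → ℂ} (hw : ∀ n, HasSum (fun a => u a * v (n - a)) (w n)) : HasSum w (s * t) := by
  have h := hu.mul hv (summable_mul_of_summable_norm hu.summable.norm hv.summable.norm)
  let e : ℤ × ℤ ≃ ℤ × ℤ :=
    { toFun := fun p => (p.2, p.1 - p.2)
      invFun := fun p => (p.1 + p.2, p.1)
      left_inv := fun p => by simp
      right_inv := fun p => by simp }
  exact HasSum.prod_fiberwise (e.hasSum_iff.mpr h) hw

lemma mul (hF : IsExpansion F f) (hG : IsExpansion G g) : IsExpansion (F * G) (f * g) := by
  filter_upwards [hF, hG] with z hz hz'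
  exact hz.convolution hz' fun n => hasSum_coeff_mul F G (qq_ne_zero _) n

lemma single (n : ℤ) : IsExpansion (HahnSeries.single n 1) (fun z => qq z ^ n) := by
  refine Eventually.of_forall fun z => ?_
  convert hasSum_ite_eq n (qq z ^ n) using 2 with m
  rw [HahnSeries.coeff_single]
  split_ifs with h <;> simp [h]

lemma intCast (c : ℤ) : IsExpansion c (fun _ => c) := by
  refine Eventually.of_forall fun z => ?_
  convert hasSum_ite_eq (0 : ℤ) (c : ℂ) using 2 with m
  rw [coeff_intCast_series]
  split_ifs with h <;> simp [h]

lemma aeval (hF : IsExpansion F f) (P : Polynomial ℤ) :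
    IsExpansion (Polynomial.aeval F P) (Polynomial.aeval f P) := by
  induction P using Polynomial.induction_on with
  | C a => simpa using! intCast a
  | add P Q hP hQ => simpa using hP.add hQ
  | monomial n a h =>
    have := h.mul hF
    simpa [pow_succ, ← mul_assoc] using this

lemma dilate (hF : IsExpansion F f) :
    IsExpansion (dilate F) (fun z => f (affineMap 2 0 two_pos z)) := by
  filter_upwards [(tendsto_affineMap 2 0 two_pos).eventually
    (show ∀ᶠ z : ℍ in atImInfty, _ from hF)] with z hz
  have hinj : Function.Injective fun n : ℤ => 2 * n := fun a b h => by simpa using h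
  rw [← hinj.hasSum_iff]
  · convert hz using 2 with n
    rw [Function.comp_apply, coeff_dilate, qq_affineMap_two, _root_.zpow_mul, zpow_ofNat]
  · intro n hn
    rw [coeff_dilate_of_odd, Int.cast_zero, zero_mul]
    rw [← Int.not_even_iff_odd, even_iff_exists_two_mul]
    rintro ⟨k, rfl⟩
    exact hn ⟨k, rfl⟩

lemma tendsto_zero (hF : IsExpansion F f) (h : IsPositive F) : Tendsto f atImInfty (𝓝 0) := by
  obtain ⟨A, hA⟩ := (atImInfty_mem {z | _}).mp hF
  set z₀ : ℍ := ⟨(max A 1 : ℝ) * Complex.I, by simp⟩ with hz₀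
  have him : A ≤ z₀.im := by
    change A ≤ ((max A 1 : ℝ) * Complex.I : ℂ).im
    simp
  have hs : Summable _ := (hA z₀ him).summable.norm
  have hq₀ : 0 < ‖qq z₀‖ := norm_pos_iff.mpr (qq_ne_zero _)
  have hbound (z : ℍ) (hz : z₀.im ≤ z.im) :
      ‖f z‖ ≤ (‖qq z‖ / ‖qq z₀‖) * ∑' n : ℤ, ‖(F.coeff n : ℂ) * qq z₀ ^ n‖ := by
    refine (hA z (him.trans hz)).norm_le_of_bounded (hs.hasSum.mul_left _) fun n => ?_
    rcases le_or_gt n 0 with hn | hn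
    · simp [h n hn]
    obtain ⟨k, rfl⟩ : ∃ k : ℕ, n = k + 1 := ⟨(n - 1).toNat, by omega⟩
    rw [norm_mul, norm_mul, norm_zpow, norm_zpow, mul_left_comm]
    refine mul_le_mul_of_nonneg_left ?_ (norm_nonneg _)
    rw [zpow_add_one₀ hq₀.ne', zpow_add_one₀ (norm_ne_zero_iff.mpr (qq_ne_zero _)), div_mul_comm,
      mul_div_cancel_right₀ _ hq₀.ne']
    refine mul_le_mul_of_nonneg_right ?_ (norm_nonneg _)
    rw [zpow_natCast, zpow_natCast]
    exact pow_le_pow_left₀ (norm_nonneg _) (norm_qq_le hz) k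
  refine squeeze_zero_norm' (a := fun z : ℍ => (‖qq z‖ / ‖qq z₀‖) *
    ∑' n : ℤ, ‖(F.coeff n : ℂ) * qq z₀ ^ n‖) ?_ ?_
  · exact (atImInfty_mem _).mpr ⟨z₀.im, fun z hz => hbound z hz⟩
  · simpa using (tendsto_norm_qq.div_const _).mul_const _

lemma sub (hF : IsExpansion F f) (hG : IsExpansion G g) : IsExpansion (F - G) (f - g) := by
  have := hF.add ((intCast (-1)).mul hG)
  convert this using 1
  · push_cast; ring
  · ext z; simp [sub_eq_add_neg]

lemma tendsto_coeff_zero (hF : IsExpansion F f) (h : ∀ j < 0, F.coeff j = 0) :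
    Tendsto f atImInfty (𝓝 (F.coeff 0 : ℂ)) := by
  have := (hF.sub (intCast (F.coeff 0))).tendsto_zero fun j hj => by
    rcases hj.lt_or_eq with hj | rfl
    · simp [coeff_intCast_series, h j hj, hj.ne]
    · simp [coeff_intCast_series]
  simpa using this.add_const (F.coeff 0 : ℂ)

lemma eq_zero (hF : IsExpansion F 0) : F = 0 := by
  by_contra hne
  have h1 : HasLead F F.order (F.coeff F.order) :=
    ⟨fun j hj => HahnSeries.coeff_eq_zero_of_lt_order hj, rfl⟩
  have h2 : HasLead (HahnSeries.single (-F.order) (1 : ℤ) : LaurentSeries ℤ) (-F.order) 1 :=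
    ⟨fun j hj => HahnSeries.coeff_single_of_ne hj.ne, HahnSeries.coeff_single_same _ _⟩
  have h3 := h1.mul h2
  rw [add_neg_cancel, mul_one] at h3
  have h4 := (hF.mul (single (-F.order))).tendsto_coeff_zero h3.1
  rw [zero_mul, h3.2] at h4
  have h5 := tendsto_nhds_unique h4 tendsto_const_nhds
  exact HahnSeries.coeff_order_eq_zero.not.mpr hne (Int.cast_eq_zero.mp h5)

lemma unique (hF : IsExpansion F f) (hG : IsExpansion G f) : F = G :=
  sub_eq_zero.mp (eq_zero (by simpa using hF.sub hG))

end IsExpansion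

lemma IsCanonicalBasis0.exists_isExpansion {N m : ℕ} [NeZero N] (hm : 0 < m) {f : ℍ → ℂ}
    {a : ℕ → ℤ} (h : IsCanonicalBasis0 N m f a) : ∃ F : LaurentSeries ℤ, IsExpansion F f ∧
      (∀ j ≤ 0, F.coeff j = if j = -(m : ℤ) then 1 else 0) ∧
      ∀ n : ℕ, 0 < n → F.coeff n = a n := by
  let c : ℤ → ℤ := fun j => if j = -(m : ℤ) then 1 else if 0 < j then a j.toNat else 0
  let F : LaurentSeries ℤ := HahnSeries.ofSuppBddBelow c ⟨-m, fun j hj => by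
    by_contra hlt
    refine hj ?_
    simp only [c]
    rw [if_neg (by omega), if_neg (by omega)]⟩
  have hF (j : ℤ) : F.coeff j = c j := rfl
  refine ⟨F, ?_, fun j hj => ?_, fun n hn => ?_⟩
  · obtain ⟨z₁, hz₁⟩ : ∃ z : ℍ, Summable fun n : ℕ => (a (n + 1) : ℂ) * qq z ^ (n + 1) := by
      by_contra! hns
      have hf (z : ℍ) : f z = qq z ^ (-(m : ℤ)) := by
        rw [h.2 z, tsum_eq_zero_of_not_summable (hns z), add_zero]
      let γ : SL(2, ℤ) := ⟨!![1, 0; N, 1], by simp⟩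
      have hγ : γ ∈ CongruenceSubgroup.Gamma0 N := by rw [CongruenceSubgroup.Gamma0_mem]; simp [γ]
      have hinv := (mem_sharpSubalgebra h.1).2.1 γ hγ UpperHalfPlane.I
      rw [hf, hf] at hinv
      have h1 := congrArg norm hinv
      rw [norm_zpow, norm_zpow, norm_qq, norm_qq, _root_.zpow_neg, _root_.zpow_neg, _root_.inv_inj,
        zpow_natCast,
        zpow_natCast, pow_left_inj₀ (Real.exp_pos _).le (Real.exp_pos _).le hm.ne',
        Real.exp_eq_exp] at h1
      have h2 := mul_left_cancel₀ (by linarith [Real.pi_pos] : -2 * Real.pi ≠ 0) h1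
      have hden : denom γ UpperHalfPlane.I = N * Complex.I + 1 := by
        rw [ModularGroup.denom_apply]
        simp [γ]
      have hnorm : Complex.normSq (N * Complex.I + 1) = (N : ℝ) ^ 2 + 1 := by
        simp [Complex.normSq_apply]; ring
      have hN : (0 : ℝ) < (N : ℝ) ^ 2 := by have := NeZero.pos N; positivity
      rw [ModularGroup.im_smul_eq_div_normSq, hden, hnorm, UpperHalfPlane.I_im,
        div_eq_iff (by positivity)] at h2
      linarith
    refine (atImInfty_mem {z | _}).mpr ⟨z₁.im, fun z hz => ?_⟩
    have hs : Summable fun n : ℕ => (a (n + 1) : ℂ) * qq z ^ (n + 1) := by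
      refine Summable.of_norm_bounded hz₁.norm fun n => ?_
      rw [norm_mul, norm_mul, norm_pow, norm_pow]
      gcongr
      exact norm_qq_le hz
    have hinj : Function.Injective fun n : ℕ => (n : ℤ) + 1 := fun a b h => by simpa using h
    have h1 : HasSum (fun j : ℤ => ((if 0 < j then a j.toNat else 0 : ℤ) : ℂ) * qq z ^ j)
        (∑' n : ℕ, (a (n + 1) : ℂ) * qq z ^ (n + 1)) := by
      rw [← hinj.hasSum_iff]
      · convert hs.hasSum using 2 with n
        simp only [Function.comp_apply]
        rw [if_pos (by omega)]
        norm_cast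
      · intro j hj
        rw [if_neg, Int.cast_zero, zero_mul]
        exact fun h => hj ⟨(j - 1).toNat, by dsimp only; omega⟩
    rw [Set.mem_ofPred_eq, h.2 z]
    convert (hasSum_ite_eq (-(m : ℤ)) (qq z ^ (-(m : ℤ)))).add h1 using 2 with j
    rw [hF]
    simp only [c]
    split_ifs with h1 h2 h2
    · omega
    · simp [h1]
    · simp
    · simp
  · rw [hF]
    simp only [c]
    rw [if_neg (not_lt.mpr hj)]
  · rw [hF]
    simp only [c]
    rw [if_neg (by omega), if_pos (by omega), Int.toNat_natCast]

lemma exists_isBigO_exp_of_periodic {f : ℍ → ℂ} (hf : MDifferentiable 𝓘(ℂ) 𝓘(ℂ) f) {w : ℝ}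
    (hw : 0 < w) (hper : ∀ z, f (affineMap 1 w one_pos z) = f z) (hb : IsBoundedAtImInfty f) :
    ∃ c, (fun z : ℍ => f z - c) =O[atImInfty] fun z => Real.exp (-2 * Real.pi * z.im / w) := by
  refine ⟨_, exp_decay_sub_atImInfty hw (fun z => ?_) hf hb⟩
  by_cases! hz : 0 < im z
  · have : 0 < im (z + w) := by simp [hz]
    simp only [Function.comp_apply, ofComplex_apply_of_im_pos this, ofComplex_apply_of_im_pos hz]
    rw [← hper ⟨z, hz⟩]
    congr 1
    apply UpperHalfPlane.ext
    simp
  · have : im (z + w) ≤ 0 := by simpa using hz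
    simp [ofComplex_apply_of_im_nonpos this, ofComplex_apply_of_im_nonpos hz]

lemma exists_tendsto_of_periodic {f : ℍ → ℂ} (hf : MDifferentiable 𝓘(ℂ) 𝓘(ℂ) f) {w : ℝ}
    (hw : 0 < w) (hper : ∀ z, f (affineMap 1 w one_pos z) = f z) (hb : IsBoundedAtImInfty f) :
    ∃ c, Tendsto f atImInfty (𝓝 c) := by
  obtain ⟨c, hc⟩ := exists_isBigO_exp_of_periodic hf hw hper hb
  exact ⟨c, tendsto_sub_nhds_zero_iff.mp (hc.trans_tendsto (tendsto_exp_im_div hw))⟩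

lemma isBoundedAtImInfty_of_tendsto {f : ℍ → ℂ} {c : ℂ} (h : Tendsto f atImInfty (𝓝 c)) :
    IsBoundedAtImInfty f :=
  h.isBigO_one ℝ

lemma mdifferentiable_comp_smul {f : ℍ → ℂ} (hf : MDifferentiable 𝓘(ℂ) 𝓘(ℂ) f) (γ : SL(2, ℤ)) :
    MDifferentiable 𝓘(ℂ) 𝓘(ℂ) (fun z => f (γ • z)) :=
  hf.comp (mdifferentiable_smul (g := (γ : GL (Fin 2) ℝ)) (by simp))

section

variable {N : ℕ} {f : ℍ → ℂ}

lemma eq_const_of_tendsto [NeZero N] (hf : f ∈ sharpSubalgebra N) {c : ℂ}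
    (h : Tendsto f atImInfty (𝓝 c)) : f = fun _ => c := by
  obtain ⟨d, rfl⟩ := sharpSubalgebra_eq_const hf (isBoundedAtImInfty_of_tendsto h)
  rw [tendsto_nhds_unique h tendsto_const_nhds]

lemma apply_smul_eq_of_dvd (hf : f ∈ sharpSubalgebra N) {γ γ' : SL(2, ℤ)}
    (h : (N : ℤ) ∣ γ 1 0 * γ' 1 1 - γ 1 1 * γ' 1 0) (z : ℍ) : f (γ • z) = f (γ' • z) := by
  have hmem : γ * γ'⁻¹ ∈ CongruenceSubgroup.Gamma0 N := by
    rw [CongruenceSubgroup.Gamma0_mem, ZMod.intCast_zmod_eq_zero_iff_dvd]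
    convert h using 1
    change (γ.1 * γ'.1.adjugate) 1 0 = _
    rw [Matrix.mul_apply, Fin.sum_univ_two, Matrix.adjugate_fin_two]
    simp
    ring
  rw [← hf.2.1 _ hmem (γ' • z), ← mul_smul, inv_mul_cancel_right]

lemma SL2_det_eq_one (γ : SL(2, ℤ)) : γ 0 0 * γ 1 1 - γ 0 1 * γ 1 0 = 1 := by
  have := γ.det_coe
  rwa [Matrix.det_fin_two] at this

/-- Every product of an upper triangular matrix and `γ` can be rewritten as `γ'` times an upper
triangular matrix. -/
lemma exists_affineMap_smul_eq {k n : ℕ} (hk : 0 < k) (hn : 0 < n) (l : ℤ) {r s : ℝ} (hr : 0 < r)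
    (hrn : r * n = k) (hsn : s * n = l) (γ : SL(2, ℤ)) :
    ∃ (γ' : SL(2, ℤ)) (r' s' : ℝ) (hr' : 0 < r'),
      γ' 1 0 * (Int.gcd (k * γ 0 0 + l * γ 1 0) (n * γ 1 0) : ℤ) = n * γ 1 0 ∧
      ∀ z, affineMap r s hr (γ • z) = γ' • affineMap r' s' hr' z := by
  set x := k * γ 0 0 + l * γ 1 0 with hx
  set y := n * γ 1 0 with hy
  have hdet := SL2_det_eq_one γ
  have hp : (0 : ℤ) < Int.gcd x y := by
    rw [Int.natCast_pos, Int.gcd_pos_iff]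
    by_contra! h
    obtain ⟨h1, h2⟩ := h
    have h3 : γ 1 0 = 0 := by
      rcases mul_eq_zero.mp (hy ▸ h2) with h | h
      · omega
      · exact h
    rw [hx, h3, mul_zero, add_zero] at h1
    have h4 : γ 0 0 = 0 := by
      rcases mul_eq_zero.mp h1 with h | h
      · omega
      · exact h
    rw [h3, h4] at hdet
    simp at hdet
  obtain ⟨A, hA⟩ := Int.gcd_dvd_left x y
  obtain ⟨C, hC⟩ := Int.gcd_dvd_right x y
  have hbez := Int.gcd_eq_gcd_ab x y
  set u := Int.gcdA x y
  set v := Int.gcdB x y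
  set p : ℤ := (Int.gcd x y : ℤ)
  have hone : A * u + C * v = 1 := by
    apply mul_left_cancel₀ hp.ne'
    linear_combination -hbez - u * hA - v * hC
  have hpR : (0 : ℝ) < p := by exact_mod_cast hp
  have hkR : (0 : ℝ) < k := by exact_mod_cast hk
  have hnR : (0 : ℝ) < n := by exact_mod_cast hn
  have hxR : (p * A : ℝ) = k * γ 0 0 + l * γ 1 0 := by exact_mod_cast hA.symm.trans hx
  have hyR : (p * C : ℝ) = n * γ 1 0 := by exact_mod_cast hC.symm.trans hy
  have hdetR : (γ 0 0 * γ 1 1 - γ 0 1 * γ 1 0 : ℝ) = 1 := by exact_mod_cast hdet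
  have honeR : (A * u + C * v : ℝ) = 1 := by exact_mod_cast hone
  have hr0 : r = k / n := by field_simp; linarith
  have hs0 : s = l / n := by field_simp; linarith
  refine ⟨⟨!![A, -v; C, u], by rw [Matrix.det_fin_two]; simp; linarith⟩, p ^ 2 / (k * n),
    p / k * (u * (k * γ 0 1 + l * γ 1 1) / n + v * γ 1 1), by positivity, ?_, ?_⟩
  · simp only [Matrix.of_apply, Matrix.cons_val]
    linarith
  · refine affineMap_smul (l := p / k) _ _ (by positivity) ?_ ?_ ?_ ?_
    · simp only [Matrix.of_apply, Matrix.cons_val, hr0, hs0]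
      field_simp
      linear_combination hxR
    · simp only [Matrix.of_apply, Matrix.cons_val, hr0, hs0]
      push_cast
      field_simp
      linear_combination p * (k * γ 0 1 + l * γ 1 1) * honeR + v * n * γ 1 1 * hxR -
        (k * γ 0 1 + l * γ 1 1) * v * hyR + v * n * k * hdetR
    · simp only [Matrix.of_apply, Matrix.cons_val]
      field_simp
      linear_combination hyR
    · simp only [Matrix.of_apply, Matrix.cons_val]
      field_simp
      linear_combination p * γ 1 1 * n * honeR + u * (k * γ 0 1 + l * γ 1 1) * hyR -
        γ 1 1 * n * u * hxR - u * n * k * hdetR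

lemma isBoundedAtImInfty_comp_affineMap_smul (hf : f ∈ sharpSubalgebra N) {k n : ℕ} (hk : 0 < k)
    (hn : 0 < n) (l : ℤ) {r s : ℝ} (hr : 0 < r) (hrn : r * n = k) (hsn : s * n = l) (γ : SL(2, ℤ))
    (h : ∀ t : ℤ, N * t * (Int.gcd (k * γ 0 0 + l * γ 1 0) (n * γ 1 0) : ℤ) ≠ n * γ 1 0) :
    IsBoundedAtImInfty fun z => f (affineMap r s hr (γ • z)) := by
  obtain ⟨γ', r', s', hr', h1, h2⟩ := exists_affineMap_smul_eq hk hn l hr hrn hsn γ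
  simp_rw [h2]
  refine (hf.2.2 γ' ?_).comp_tendsto (tendsto_affineMap r' s' hr')
  rintro ⟨t, ht⟩
  exact h t (ht ▸ h1)

end

lemma exists_eq_mul_of_mem_Gamma0 {N : ℕ} {γ : SL(2, ℤ)}
    (hγ : γ ∈ CongruenceSubgroup.Gamma0 N) : ∃ c : ℤ, γ 1 0 = N * c := by
  rwa [CongruenceSubgroup.Gamma0_mem, ZMod.intCast_zmod_eq_zero_iff_dvd] at hγ

lemma comp_two_mul_mem {f : ℍ → ℂ} (hf : f ∈ sharpSubalgebra 8) :
    (fun z => f (affineMap 2 0 two_pos z)) ∈ sharpSubalgebra 16 := by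
  refine ⟨mdifferentiable_comp_affineMap hf.1 _ _ _, fun γ hγ z => ?_, fun γ hγ => ?_⟩
  · obtain ⟨c, hc⟩ := exists_eq_mul_of_mem_Gamma0 hγ
    have hdet := SL2_det_eq_one γ
    push_cast at hc
    rw [hc] at hdet
    let γ' : SL(2, ℤ) := ⟨!![γ 0 0, 2 * γ 0 1; 8 * c, γ 1 1], by
      rw [Matrix.det_fin_two]; simp; linarith⟩
    have hγ' : γ' ∈ CongruenceSubgroup.Gamma0 8 := by
      rw [CongruenceSubgroup.Gamma0_mem, ZMod.intCast_zmod_eq_zero_iff_dvd]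
      simp [γ']
    beta_reduce
    rw [affineMap_smul (γ' := γ') (r' := 2) (s' := 0) two_pos two_pos one_ne_zero,
      hf.2.1 γ' hγ']
    all_goals simp [γ', hc]
    all_goals ring
  · refine isBoundedAtImInfty_comp_affineMap_smul hf (k := 2) (n := 1) two_pos one_pos 0 two_pos
      (by simp) (by simp) γ fun t ht => hγ ?_
    have h2 : (2 : ℤ) ∣ Int.gcd ((2 : ℕ) * γ 0 0 + 0 * γ 1 0) ((1 : ℕ) * γ 1 0) := by
      refine Int.dvd_coe_gcd ⟨γ 0 0, by simp⟩ ?_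
      rw [← ht]
      exact ⟨4 * t * Int.gcd _ _, by push_cast; ring⟩
    obtain ⟨p, hp⟩ := h2
    rw [hp] at ht
    exact ⟨t * p, by push_cast at ht ⊢; linarith⟩

lemma comp_add_quarter_mem {f : ℍ → ℂ} (hf : f ∈ sharpSubalgebra 16) :
    (fun z => f (affineMap 1 (1 / 4) one_pos z)) ∈ sharpSubalgebra 16 := by
  refine ⟨mdifferentiable_comp_affineMap hf.1 _ _ _, fun γ hγ z => ?_, fun γ hγ => ?_⟩
  · obtain ⟨c, hc⟩ := exists_eq_mul_of_mem_Gamma0 hγ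
    have hdet := SL2_det_eq_one γ
    push_cast at hc
    rw [hc] at hdet
    obtain ⟨e, he⟩ : (4 : ℤ) ∣ γ 1 1 - γ 0 0 := by
      have h4 := congrArg (Int.cast : ℤ → ZMod 4) hdet
      have h16 : (16 : ZMod 4) = 0 := by decide
      push_cast at h4
      rw [h16, zero_mul, mul_zero, sub_zero] at h4
      have key : ∀ x y : ZMod 4, x * y = 1 → y - x = 0 := by decide
      have h := key _ _ h4
      rw [← Int.cast_sub] at h
      exact (ZMod.intCast_zmod_eq_zero_iff_dvd _ 4).mp h
    let γ' : SL(2, ℤ) := ⟨!![γ 0 0 + 4 * c, γ 0 1 + e - c; 16 * c, γ 1 1 - 4 * c], by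
      rw [Matrix.det_fin_two]; simp
      linear_combination hdet + 4 * c * he⟩
    have hγ' : γ' ∈ CongruenceSubgroup.Gamma0 16 := by
      rw [CongruenceSubgroup.Gamma0_mem, ZMod.intCast_zmod_eq_zero_iff_dvd]
      simp [γ']
    have heR : (γ 1 1 - γ 0 0 : ℝ) = 4 * e := by exact_mod_cast he
    beta_reduce
    rw [affineMap_smul (γ' := γ') (r' := 1) (s' := 1 / 4) one_pos one_pos one_ne_zero,
      hf.2.1 γ' hγ']
    all_goals simp [γ', hc]
    all_goals linarith
  · refine isBoundedAtImInfty_comp_affineMap_smul hf (k := 4) (n := 4) four_pos four_pos 1 one_pos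
      (by simp) (by simp) γ fun t ht => hγ ?_
    have hc : γ 1 0 = 4 * (t * Int.gcd ((4 : ℕ) * γ 0 0 + 1 * γ 1 0) ((4 : ℕ) * γ 1 0)) := by
      push_cast at ht ⊢
      linarith
    have h2 : (4 : ℤ) ∣ Int.gcd ((4 : ℕ) * γ 0 0 + 1 * γ 1 0) ((4 : ℕ) * γ 1 0) := by
      refine Int.dvd_coe_gcd (dvd_add ⟨γ 0 0, by simp⟩ ?_) ⟨γ 1 0, by simp⟩
      rw [one_mul]
      exact ⟨_, hc⟩
    obtain ⟨p, hp⟩ := h2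
    rw [hp] at hc
    exact ⟨t * p, by push_cast; linarith⟩

lemma qq_affineMap_quarter (z : ℍ) :
    qq (affineMap 1 (1 / 4) one_pos z) = Complex.I * qq z := by
  have h : qq (1 / 4) = Complex.I := by
    rw [qq]
    convert Complex.exp_pi_div_two_mul_I using 2
    ring
  rw [coe_affineMap, ← h, ← qq_add]
  congr 1
  push_cast
  ring

/-- The function `f` on the upper half-plane, with expansion `F`, is the Hauptmodul of `Γ₀(N)` with
a simple pole at `∞` and vanishing constant term. -/
structure IsHauptmodul (N : ℕ) (F : LaurentSeries ℤ) (f : ℍ → ℂ) : Prop where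
  mem : f ∈ sharpSubalgebra N
  isExpansion : IsExpansion F f
  coeff : ∀ j ≤ 0, F.coeff j = if j = -1 then 1 else 0

namespace IsHauptmodul

variable {N : ℕ} {F : LaurentSeries ℤ} {f : ℍ → ℂ}

lemma hasLead (h : IsHauptmodul N F f) : HasLead F (-1) 1 :=
  ⟨fun j hj => by rw [h.coeff j (by omega), if_neg hj.ne], by simp [h.coeff]⟩

lemma isPositive (h : IsHauptmodul N F f) : IsPositive (F - HahnSeries.single (-1) 1) :=
  fun j hj => by
    rw [HahnSeries.coeff_sub, h.coeff j hj, HahnSeries.coeff_single]; split_ifs <;> simp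

lemma tendsto (h : IsHauptmodul N F f) :
    Tendsto (fun z : ℍ => f z - (qq z)⁻¹) atImInfty (𝓝 0) := by
  simpa using! (h.isExpansion.sub (.single (-1))).tendsto_zero h.isPositive

lemma tendsto_sq (h : IsHauptmodul N F f) :
    ∃ L, Tendsto (fun z : ℍ => f z ^ 2 - (qq z)⁻¹ ^ 2) atImInfty (𝓝 L) := by
  have h1 := (IsExpansion.single (-1)).mul (h.isExpansion.sub (.single (-1)))
  have h2 : HasLead (F - HahnSeries.single (-1) 1) 1 (F.coeff 1) :=
    ⟨fun j hj => h.isPositive j (by omega), by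
      rw [HahnSeries.coeff_sub, HahnSeries.coeff_single_of_ne (by norm_num), sub_zero]⟩
  have h3 : HasLead (HahnSeries.single (-1) (1 : ℤ) : LaurentSeries ℤ) (-1) 1 :=
    ⟨fun j hj => HahnSeries.coeff_single_of_ne hj.ne, HahnSeries.coeff_single_same _ _⟩
  have h4 := h1.tendsto_coeff_zero (h3.mul h2).1
  refine ⟨_, ((h.tendsto.pow 2).add (h4.const_mul 2)).congr fun z => ?_⟩
  simp
  ring

lemma comp_add_quarter (h : IsHauptmodul 16 F f) (z : ℍ) :
    f (affineMap 1 (1 / 4) one_pos z) = -Complex.I * f z := by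
  have hmem : (fun z => f (affineMap 1 (1 / 4) one_pos z)) + Complex.I • f ∈ sharpSubalgebra 16 :=
    add_mem (comp_add_quarter_mem h.mem) (Subalgebra.smul_mem _ h.mem _)
  have hlim : Tendsto ((fun z => f (affineMap 1 (1 / 4) one_pos z)) + Complex.I • f) atImInfty
      (𝓝 0) := by
    have := (h.tendsto.comp (tendsto_affineMap 1 (1 / 4) one_pos)).add
      (h.tendsto.const_mul Complex.I)
    rw [mul_zero, add_zero] at this
    refine this.congr fun z => ?_
    simp only [Function.comp_apply, qq_affineMap_quarter, mul_inv, Complex.inv_I, Pi.add_apply,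
      Pi.smul_apply, smul_eq_mul]
    ring
  have := congrFun (eq_const_of_tendsto hmem hlim) z
  simp only [Pi.add_apply, Pi.smul_apply, smul_eq_mul] at this
  linear_combination this

lemma comp_add_half (h : IsHauptmodul 16 F f) (z : ℍ) :
    f (affineMap 1 (1 / 2) one_pos z) = -f z := by
  have : affineMap 1 (1 / 2) one_pos z =
      affineMap 1 (1 / 4) one_pos (affineMap 1 (1 / 4) one_pos z) := by
    apply UpperHalfPlane.ext
    simp
    ring
  rw [this, h.comp_add_quarter, h.comp_add_quarter]
  linear_combination f z * Complex.I_sq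

lemma sq_eq {F G : LaurentSeries ℤ} {f g : ℍ → ℂ} (hf : IsHauptmodul 16 F f)
    (hg : IsHauptmodul 8 G g) (z : ℍ) : f z ^ 2 = g (affineMap 2 0 two_pos z) := by
  obtain ⟨L, hL⟩ := hf.tendsto_sq
  have hL0 : L = 0 := by
    have h1 := hL.comp (tendsto_affineMap 1 (1 / 4) one_pos)
    have h2 : Tendsto _ _ (𝓝 (-L)) := hL.neg
    have h3 := tendsto_nhds_unique (h1.congr fun z => ?_) h2
    · linear_combination h3 / 2
    · simp only [Function.comp_apply, qq_affineMap_quarter, mul_inv, Complex.inv_I,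
        hf.comp_add_quarter]
      linear_combination (f z ^ 2 - (qq z)⁻¹ ^ 2) * Complex.I_sq
  have hmem : f ^ 2 - (fun z => g (affineMap 2 0 two_pos z)) ∈ sharpSubalgebra 16 :=
    sub_mem (pow_mem hf.mem 2) (comp_two_mul_mem hg.mem)
  have hlim : Tendsto (f ^ 2 - (fun z => g (affineMap 2 0 two_pos z))) atImInfty (𝓝 0) := by
    have := hL.sub (hg.tendsto.comp (tendsto_affineMap 2 0 two_pos))
    rw [hL0, sub_zero] at this
    refine this.congr fun z => ?_
    simp only [Function.comp_apply, qq_affineMap_two, inv_pow, Pi.sub_apply, Pi.pow_apply]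
    ring
  have := congrFun (eq_const_of_tendsto hmem hlim) z
  simp only [Pi.sub_apply, Pi.pow_apply] at this
  linear_combination this

end IsHauptmodul

/-- The translation by `8` at the cusp `0`, which normalizes `Γ₀(16)`. -/
def lowerEight : SL(2, ℤ) := ⟨!![1, 0; 8, 1], by simp⟩

lemma lowerEight_mul_apply_zero (γ : SL(2, ℤ)) :
    (lowerEight * γ) 1 0 = 8 * γ 0 0 + γ 1 0 := by
  change (lowerEight.1 * γ.1) 1 0 = _
  simp [Matrix.mul_apply, Fin.sum_univ_two, lowerEight]

lemma lowerEight_mul_apply_one (γ : SL(2, ℤ)) :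
    (lowerEight * γ) 1 1 = 8 * γ 0 1 + γ 1 1 := by
  change (lowerEight.1 * γ.1) 1 1 = _
  simp [Matrix.mul_apply, Fin.sum_univ_two, lowerEight]

lemma lowerEight_mul_S_smul (z : ℍ) :
    lowerEight • ModularGroup.S • z = ModularGroup.S • affineMap 1 (-8) one_pos z := by
  have h0 : (lowerEight * ModularGroup.S) 0 0 = 0 ∧ (lowerEight * ModularGroup.S) 0 1 = -1 := by
    decide
  have h1 : (lowerEight * ModularGroup.S) 1 0 = 1 ∧ (lowerEight * ModularGroup.S) 1 1 = -8 := by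
    decide
  rw [← mul_smul, ← affineMap_smul (γ := lowerEight * ModularGroup.S) (r := 1) (s := 0) one_pos
    one_pos one_ne_zero, affineMap_one_zero]
  all_goals simp only [h0.1, h0.2, h1.1, h1.2]
  all_goals simp [ModularGroup.S]

section

variable {f : ℍ → ℂ}

lemma lowerEight_smul_eq (hf : f ∈ sharpSubalgebra 16) {γ : SL(2, ℤ)}
    (hγ : γ ∈ CongruenceSubgroup.Gamma0 16) (z : ℍ) :
    f (lowerEight • γ • z) = f (lowerEight • z) := by
  rw [← mul_smul]
  refine apply_smul_eq_of_dvd hf ?_ z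
  obtain ⟨c, hc⟩ := exists_eq_mul_of_mem_Gamma0 hγ
  have hdet := SL2_det_eq_one γ
  push_cast at hc
  have hodd : Odd (γ 0 0 * γ 1 1) := ⟨8 * γ 0 1 * c, by rw [hc] at hdet; linarith⟩
  obtain ⟨⟨a, ha⟩, ⟨d, hd⟩⟩ := Int.odd_mul.mp hodd
  rw [lowerEight_mul_apply_zero, lowerEight_mul_apply_one]
  refine ⟨a - d + c - 4 * γ 0 1, ?_⟩
  rw [hc, ha, hd]
  simp [lowerEight]
  ring

lemma smul_eq_of_mem_Gamma0_eight (hf : f ∈ sharpSubalgebra 16) {γ : SL(2, ℤ)}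
    (hγ : γ ∈ CongruenceSubgroup.Gamma0 8) (hγ' : γ ∉ CongruenceSubgroup.Gamma0 16) (z : ℍ) :
    f (γ • z) = f (lowerEight • z) ∧ f (lowerEight • γ • z) = f z := by
  obtain ⟨c, hc⟩ := exists_eq_mul_of_mem_Gamma0 hγ
  have hdet := SL2_det_eq_one γ
  push_cast at hc
  rw [hc] at hdet
  obtain ⟨k, hk⟩ : Odd c := by
    rw [← Int.not_even_iff_odd]
    rintro ⟨k, hk⟩
    apply hγ'
    rw [CongruenceSubgroup.Gamma0_mem, ZMod.intCast_zmod_eq_zero_iff_dvd]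
    exact ⟨k, by push_cast; linarith⟩
  have hodd : Odd (γ 0 0 * γ 1 1) := ⟨4 * γ 0 1 * c, by linarith⟩
  obtain ⟨⟨a, ha⟩, ⟨d, hd⟩⟩ := Int.odd_mul.mp hodd
  constructor
  · refine apply_smul_eq_of_dvd hf ⟨k - d, ?_⟩ z
    rw [hc, hk, hd]
    simp [lowerEight]
    ring
  · rw [← mul_smul]
    nth_rw 2 [← one_smul (SL(2, ℤ)) z]
    refine apply_smul_eq_of_dvd hf ⟨a + k + 1, ?_⟩ z
    rw [lowerEight_mul_apply_zero, hc, hk, ha]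
    simp
    ring

lemma symmetric_mem {p : ℍ → ℂ} (hf : f ∈ sharpSubalgebra 16)
    (hp : MDifferentiable 𝓘(ℂ) 𝓘(ℂ) p) (φ : ℂ → ℂ → ℂ) (hφ : ∀ a b, φ a b = φ b a)
    (hpf : ∀ z, p z = φ (f z) (f (lowerEight • z)))
    (hb : ∀ u v : ℍ → ℂ, IsBoundedAtImInfty u → IsBoundedAtImInfty v →
      IsBoundedAtImInfty fun z => φ (u z) (v z)) : p ∈ sharpSubalgebra 8 := by
  refine ⟨hp, fun γ hγ z => ?_, fun γ hγ => ?_⟩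
  · by_cases h : γ ∈ CongruenceSubgroup.Gamma0 16
    · rw [hpf, hpf, hf.2.1 γ h, lowerEight_smul_eq hf h]
    · obtain ⟨h1, h2⟩ := smul_eq_of_mem_Gamma0_eight hf hγ h z
      rw [hpf, hpf, h1, h2, hφ]
  · simp_rw [hpf, ← mul_smul]
    refine hb _ _ (hf.2.2 γ fun ⟨t, ht⟩ => hγ ⟨2 * t, ?_⟩)
      (hf.2.2 (lowerEight * γ) fun ⟨t, ht⟩ => hγ ⟨2 * t - γ 0 0, ?_⟩)
    · push_cast at ht ⊢; linarith
    · rw [lowerEight_mul_apply_zero] at ht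
      push_cast at ht ⊢; linarith

end

namespace IsHauptmodul

variable {F G : LaurentSeries ℤ} {f g : ℍ → ℂ}

lemma lowerEight_comp_add_half (hf : IsHauptmodul 16 F f) (z : ℍ) :
    f (lowerEight • affineMap 1 (1 / 2) one_pos z) = -f (lowerEight • z) := by
  let γ' : SL(2, ℤ) := ⟨!![5, -2; 8, -3], by simp [Matrix.det_fin_two]⟩
  have h : affineMap 1 (1 / 2) one_pos (lowerEight • z) =
      γ' • affineMap 1 (1 / 2) one_pos z := by
    refine affineMap_smul one_pos one_pos one_ne_zero ?_ ?_ ?_ ?_ z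
    all_goals simp [γ', lowerEight]
    all_goals norm_num
  rw [← hf.comp_add_half, h]
  exact apply_smul_eq_of_dvd hf.mem (by simp [γ', lowerEight]) _

lemma lowerEight_isBigO (hf : IsHauptmodul 16 F f) :
    (fun z => f (lowerEight • z)) =O[atImInfty] fun z => Real.exp (-2 * Real.pi * z.im) := by
  have hb : IsBoundedAtImInfty fun z => f (lowerEight • z) :=
    hf.mem.2.2 lowerEight (by simp [lowerEight])
  have hper (z : ℍ) : f (lowerEight • affineMap 1 1 one_pos z) = f (lowerEight • z) := by
    have : affineMap 1 1 one_pos z =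
        affineMap 1 (1 / 2) one_pos (affineMap 1 (1 / 2) one_pos z) := by
      apply UpperHalfPlane.ext
      simp
      ring
    rw [this, hf.lowerEight_comp_add_half, hf.lowerEight_comp_add_half, neg_neg]
  obtain ⟨c, hc⟩ := exists_isBigO_exp_of_periodic (mdifferentiable_comp_smul hf.mem.1 lowerEight)
    one_pos hper hb
  have hlim : Tendsto (fun z => f (lowerEight • z)) atImInfty (𝓝 c) :=
    tendsto_sub_nhds_zero_iff.mp (hc.trans_tendsto (tendsto_exp_im_div one_pos))
  have hc0 : c = 0 := by
    have h := tendsto_nhds_unique (hlim.comp (tendsto_affineMap 1 (1 / 2) one_pos))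
      (hlim.neg.congr fun z => (hf.lowerEight_comp_add_half z).symm)
    linear_combination h / 2
  simpa [hc0] using hc

lemma eq_add (hf : IsHauptmodul 16 F f) (hg : IsHauptmodul 8 G g) (z : ℍ) :
    g z = f z + f (lowerEight • z) := by
  have hmem : (fun z => f z + f (lowerEight • z)) - g ∈ sharpSubalgebra 8 := by
    refine sub_mem (symmetric_mem hf.mem ?_ (· + ·) add_comm (fun _ => rfl)
      fun u v hu hv => hu.add hv) hg.mem
    exact hf.mem.1.add (mdifferentiable_comp_smul hf.mem.1 lowerEight)
  have hlim : Tendsto ((fun z => f z + f (lowerEight • z)) - g) atImInfty (𝓝 0) := by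
    have h0 : Tendsto (fun z => f (lowerEight • z)) atImInfty (𝓝 0) :=
      hf.lowerEight_isBigO.trans_tendsto (by simpa using tendsto_exp_im_div one_pos)
    have := (hf.tendsto.sub hg.tendsto).add h0
    rw [sub_zero, add_zero] at this
    refine this.congr fun z => ?_
    simp only [Pi.sub_apply]
    ring
  have := congrFun (eq_const_of_tendsto hmem hlim) z
  simp only [Pi.sub_apply] at this
  linear_combination -this

lemma exists_mul_lowerEight_eq (hf : IsHauptmodul 16 F f) :
    ∃ c, ∀ z, f z * f (lowerEight • z) = c := by
  have hmem : (fun z => f z * f (lowerEight • z)) ∈ sharpSubalgebra 8 := by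
    refine symmetric_mem hf.mem ?_ (· * ·) mul_comm (fun _ => rfl) fun u v hu hv => hu.mul hv
    exact hf.mem.1.mul (mdifferentiable_comp_smul hf.mem.1 lowerEight)
  have hb : IsBoundedAtImInfty fun z => f z * f (lowerEight • z) := by
    have h1 : (fun z : ℍ => f z) =O[atImInfty] fun z => Real.exp (2 * Real.pi * z.im) := by
      have h2 : (fun z : ℍ => (qq z)⁻¹) =O[atImInfty] fun z => Real.exp (2 * Real.pi * z.im) := by
        refine IsBigO.of_bound 1 (Eventually.of_forall fun z => ?_)
        rw [norm_inv, norm_qq, ← Real.exp_neg, Real.norm_of_nonneg (Real.exp_pos _).le, one_mul,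
          Real.exp_le_exp]
        linarith
      have h3 : (fun z : ℍ => f z - (qq z)⁻¹) =O[atImInfty]
          fun z => Real.exp (2 * Real.pi * z.im) := by
        refine (hf.tendsto.isBigO_one ℝ).trans (IsBigO.of_bound 1 (Eventually.of_forall fun z => ?_))
        rw [norm_one, one_mul, Real.norm_of_nonneg (Real.exp_pos _).le, Real.one_le_exp_iff]
        have := mul_pos Real.pi_pos z.im_pos
        linarith
      simpa using h3.add h2
    refine (h1.mul hf.lowerEight_isBigO).congr_right fun z => ?_
    rw [← Real.exp_add]
    simp
  obtain ⟨c, hc⟩ := sharpSubalgebra_eq_const hmem hb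
  exact ⟨c, congrFun hc⟩

lemma mul_eq (hf : IsHauptmodul 16 F f) (hg : IsHauptmodul 8 G g) (z : ℍ) :
    f z * f (lowerEight • z) = 4 := by
  obtain ⟨c, hc⟩ := hf.exists_mul_lowerEight_eq
  have hb : IsBoundedAtImInfty fun z => f (ModularGroup.S • z) :=
    hf.mem.2.2 _ (by simp [ModularGroup.S])
  have hper (z : ℍ) :
      f (ModularGroup.S • affineMap 1 16 one_pos z) = f (ModularGroup.S • z) := by
    let γ' : SL(2, ℤ) := ⟨!![0, -1; 1, 16], by simp⟩
    have h : γ' • z = ModularGroup.S • affineMap 1 16 one_pos z := by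
      rw [← affineMap_one_zero (γ' • z)]
      refine affineMap_smul one_pos one_pos one_ne_zero ?_ ?_ ?_ ?_ z
      all_goals simp [γ', ModularGroup.S]
    rw [← h]
    exact apply_smul_eq_of_dvd hf.mem (by simp [γ', ModularGroup.S]) _
  obtain ⟨x, hx⟩ := exists_tendsto_of_periodic (mdifferentiable_comp_smul hf.mem.1 ModularGroup.S)
    (by norm_num) hper hb
  have hx' : Tendsto (fun z => f (lowerEight • ModularGroup.S • z)) atImInfty (𝓝 x) := by
    simp_rw [lowerEight_mul_S_smul]
    exact hx.comp (tendsto_affineMap 1 (-8) one_pos)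
  have hgS : Tendsto (fun z => g (ModularGroup.S • z)) atImInfty (𝓝 (x + x)) :=
    (hx.add hx').congr fun z => (hf.eq_add hg _).symm
  have hhalf (z : ℍ) : affineMap 2 0 two_pos (ModularGroup.S • z) =
      ModularGroup.S • affineMap (1 / 2) 0 one_half_pos z := by
    refine affineMap_smul (l := 1 / 2) two_pos one_half_pos (by norm_num) ?_ ?_ ?_ ?_ z
    all_goals simp [ModularGroup.S]
  have hsq : x ^ 2 = x + x := by
    refine tendsto_nhds_unique (hx.pow 2)
      ((hgS.comp (tendsto_affineMap (1 / 2) 0 one_half_pos)).congr fun z => ?_)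
    rw [hf.sq_eq hg, hhalf, Function.comp_apply]
  have hcx : c = x * x :=
    tendsto_nhds_unique (tendsto_const_nhds.congr fun z => (hc _).symm) (hx.mul hx')
  rcases eq_or_ne x 0 with rfl | hx0
  · exfalso
    rw [mul_zero] at hcx
    have h0 : f = 0 := by
      rcases (UpperHalfPlane.mul_eq_zero_iff hf.mem.1
        (mdifferentiable_comp_smul hf.mem.1 lowerEight)).mp
        (funext fun z => (hc z).trans hcx) with h | h
      · exact h
      · ext z
        simpa using congrFun h (lowerEight⁻¹ • z)
    exact hf.hasLead.ne_zero one_ne_zero (IsExpansion.eq_zero (h0 ▸ hf.isExpansion))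
  · have h2 : x = 2 := mul_left_cancel₀ hx0 (by linear_combination hsq)
    rw [hc, hcx, h2]
    norm_num

lemma relations (hf : IsHauptmodul 16 F f) (hg : IsHauptmodul 8 G g) :
    F ^ 2 = dilate G ∧ G * F = F ^ 2 + 4 := by
  have hF2 := hf.isExpansion.mul hf.isExpansion
  constructor
  · refine IsExpansion.unique (f := f * f) (by rwa [sq]) ?_
    convert hg.isExpansion.dilate using 1
    ext z
    rw [← hf.sq_eq hg, Pi.mul_apply, sq]
  · refine (hg.isExpansion.mul hf.isExpansion).unique ?_
    convert hF2.add (IsExpansion.intCast 4) using 1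
    · push_cast; ring
    · ext z
      simp only [Pi.mul_apply, Pi.add_apply, hf.eq_add hg]
      push_cast
      linear_combination hf.mul_eq hg z

end IsHauptmodul

lemma IsCanonicalBasis0.isHauptmodul {N : ℕ} [NeZero N] {f : ℍ → ℂ} {a : ℕ → ℤ}
    (h : IsCanonicalBasis0 N 1 f a) : ∃ F, IsHauptmodul N F f := by
  obtain ⟨F, hF, hF', -⟩ := h.exists_isExpansion one_pos
  exact ⟨F, mem_sharpSubalgebra h.1, hF, hF'⟩

lemma IsHauptmodul.isFaber {N m : ℕ} [NeZero N] {F : LaurentSeries ℤ} {f g : ℍ → ℂ} {a : ℕ → ℤ}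
    (hf : IsHauptmodul N F f) (hm : 0 < m) (hg : IsCanonicalBasis0 N m g a) :
    ∃ G, IsFaber F m G ∧ ∀ n : ℕ, 0 < n → G.coeff n = a n := by
  obtain ⟨G, hG, hG', hGa⟩ := hg.exists_isExpansion hm
  obtain ⟨E, ⟨P, hP⟩, hE⟩ := exists_isFaber hf.hasLead m
  have hexp := hf.isExpansion.aeval P
  rw [← hP] at hexp
  have hmem : g - Polynomial.aeval f P ∈ sharpSubalgebra N :=
    sub_mem (mem_sharpSubalgebra hg.1) <| Algebra.adjoin_le
      (S := (sharpSubalgebra N).restrictScalars ℤ) (Set.singleton_subset_iff.mpr hf.mem)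
      (Polynomial.aeval_mem_adjoin_singleton ℤ f)
  have hlim := (hG.sub hexp).tendsto_zero fun j hj => by
    rw [HahnSeries.coeff_sub, hG' j hj, hE j hj, sub_self]
  have heq : g = Polynomial.aeval f P := sub_eq_zero.mp (eq_const_of_tendsto hmem hlim)
  rw [← heq] at hexp
  exact ⟨G, (hG.unique hexp) ▸ ⟨⟨P, hP⟩, hE⟩, hGa⟩

end

/-- Divisibility of the coefficients `a₀⁽⁸⁾(m,n)` and `a₀⁽¹⁶⁾(m,n)` by high
powers of 2 when `m = 2^α m'`, `n = 2^β n'` with `m', n'` odd and `α ≠ β`. -/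
theorem congruences_levels8_16 (f8 f16 : ℕ → ℍ → ℂ) (a8 a16 : ℕ → ℕ → ℤ)
    (h8 : ∀ m, IsCanonicalBasis0 8 m (f8 m) (a8 m))
    (h16 : ∀ m, IsCanonicalBasis0 16 m (f16 m) (a16 m)) :
    ∀ α β m' n' : ℕ, Odd m' → Odd n' →
      (β < α →
        (2 : ℤ) ^ (4 * (α - β) + 8) ∣ a8 (2 ^ α * m') (2 ^ β * n') ∧
        (2 : ℤ) ^ (4 * (α - β) + 8) ∣ a16 (2 ^ α * m') (2 ^ β * n')) ∧
      (α < β →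
        (2 : ℤ) ^ (3 * (β - α) + 8) ∣ a8 (2 ^ α * m') (2 ^ β * n') ∧
        (2 : ℤ) ^ (3 * (β - α) + 8) ∣ a16 (2 ^ α * m') (2 ^ β * n')) := by
  intro α β m' n' hm hn
  obtain ⟨H, hH⟩ := (h8 1).isHauptmodul
  obtain ⟨X, hX⟩ := (h16 1).isHauptmodul
  obtain ⟨hsq, hmul⟩ := hX.relations hH
  obtain ⟨cH, cX⟩ := faberCongruence_of_relations hX.hasLead hH.hasLead hsq hmul
  have hm0 : 0 < 2 ^ α * m' := mul_pos (by positivity) hm.pos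
  have hn0 : 0 < 2 ^ β * n' := mul_pos (by positivity) hn.pos
  obtain ⟨G8, hG8, ha8⟩ := hH.isFaber hm0 (h8 _)
  obtain ⟨G16, hG16, ha16⟩ := hX.isFaber hm0 (h16 _)
  have d8 := cH α β m' n' G8 hm hn hG8
  have d16 := cX α β m' n' G16 hm hn hG16
  rw [← ha8 _ hn0, ← ha16 _ hn0]
  push_cast
  exact ⟨fun h => ⟨d8.1 h, d16.1 h⟩, fun h => ⟨d8.2 h, d16.2 h⟩⟩
end
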